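/- Let D be a model category and x, y ∈ D. Then the inclusion of the full subcategory Fun_{**}(3̃,D)^W ↪ Fun_{**}(3,D)^W induces a weak homotopy equivalence of nerves N(Fun_{**}(3̃,D)^W) → N(Fun_{**}(3,D)^W). -/

import Mathlib

open CategoryTheory CategoryTheory.Limits Simplicial

universe w v u

namespace Paper

/-- The map constant at vertex `i` of `Δ[1]`. -/
def constVertex (X : SSet.{w}) (i : Fin 2) : X ⟶ Δ[1] where
  app m := ↾fun _ => ULift.up (SimplexCategory.const m.unop ⦋1⦌ i)
  naturality _ _ _ := by rfl

/-- Elementary simplicial homotopy between two maps of simplicial sets,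
given by a map out of the cylinder `X ⨯ Δ[1]`. -/
def SHomotopy {X Y : SSet.{w}} (f g : X ⟶ Y) : Prop :=
  ∃ H : X ⨯ Δ[1] ⟶ Y,
    prod.lift (𝟙 X) (constVertex X 0) ≫ H = f ∧
    prod.lift (𝟙 X) (constVertex X 1) ≫ H = g

/-- The relation of being simplicially homotopic: the equivalence relation
generated by elementary simplicial homotopies. -/
def Htpy {X Y : SSet.{w}} (f g : X ⟶ Y) : Prop := Relation.EqvGen SHomotopy f g

/-- Kan complexes, with the definition `SSet.KanComplex` had in Mathlib in December 2024
(horns of all dimensions `n`, including `n = 0`). -/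
class KanComplex (S : SSet.{w}) : Prop where
  hornFilling : ∀ ⦃n : ℕ⦄ ⦃i : Fin (n+1)⦄ (σ₀ : (Λ[n, i] : SSet.{w}) ⟶ S),
    ∃ σ : Δ[n] ⟶ S, σ₀ = Λ[n, i].ι ≫ σ

/-- A map of simplicial sets is a weak homotopy equivalence (in the Kan–Quillen sense)
iff for every Kan complex `K` the induced map on simplicial homotopy classes of maps
into `K` is a bijection. -/
def IsWeakHomotopyEquiv {X Y : SSet.{w}} (f : X ⟶ Y) : Prop :=
  ∀ (K : SSet.{w}), KanComplex K →
    (∀ g : X ⟶ K, ∃ h : Y ⟶ K, Htpy (f ≫ h) g) ∧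
    (∀ h h' : Y ⟶ K, Htpy (f ≫ h) (f ≫ h') → Htpy h h')

/-- A simplicial set is weakly contractible if its map to the terminal object
is a weak homotopy equivalence. -/
def WeaklyContractible (X : SSet.{w}) : Prop := IsWeakHomotopyEquiv (terminal.from X)

/-- The map on nerves induced by a functor. -/
def nerveMap {C : Type u} {D : Type u} [Category.{v} C] [Category.{v} D] (F : C ⥤ D) :
    nerve C ⟶ nerve D where
  app _ := ↾fun G => G ⋙ F
  naturality _ _ _ := by rfl



/-- `f` is a retract of `g` in the arrow category. -/
def IsRetractOf {C : Type u} [Category.{v} C] {X Y X' Y' : C} (f : X ⟶ Y) (g : X' ⟶ Y') : Prop :=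
  ∃ (i : X ⟶ X') (r : X' ⟶ X) (j : Y ⟶ Y') (s : Y' ⟶ Y),
    i ≫ r = 𝟙 X ∧ j ≫ s = 𝟙 Y ∧ i ≫ g = f ≫ j ∧ r ≫ f = g ≫ s

/-- A (Quillen) model structure on a category: three wide subcategories of weak
equivalences, cofibrations and fibrations, satisfying the two-out-of-three, retract,
lifting and factorization axioms.  (No functorial factorizations are assumed; a model
category is a finitely bicomplete category equipped with such a structure.) -/
structure ModelStructure (C : Type u) [Category.{v} C] where
  W : MorphismProperty C
  Cof : MorphismProperty C
  Fib : MorphismProperty C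
  W_id : ∀ X : C, W (𝟙 X)
  Cof_id : ∀ X : C, Cof (𝟙 X)
  Fib_id : ∀ X : C, Fib (𝟙 X)
  W_comp : ∀ {X Y Z : C} (f : X ⟶ Y) (g : Y ⟶ Z), W f → W g → W (f ≫ g)
  Cof_comp : ∀ {X Y Z : C} (f : X ⟶ Y) (g : Y ⟶ Z), Cof f → Cof g → Cof (f ≫ g)
  Fib_comp : ∀ {X Y Z : C} (f : X ⟶ Y) (g : Y ⟶ Z), Fib f → Fib g → Fib (f ≫ g)
  W_of_precomp : ∀ {X Y Z : C} (f : X ⟶ Y) (g : Y ⟶ Z), W f → W (f ≫ g) → W g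
  W_of_postcomp : ∀ {X Y Z : C} (f : X ⟶ Y) (g : Y ⟶ Z), W g → W (f ≫ g) → W f
  W_retract : ∀ {X Y X' Y' : C} {f : X ⟶ Y} {g : X' ⟶ Y'}, IsRetractOf f g → W g → W f
  Cof_retract : ∀ {X Y X' Y' : C} {f : X ⟶ Y} {g : X' ⟶ Y'}, IsRetractOf f g → Cof g → Cof f
  Fib_retract : ∀ {X Y X' Y' : C} {f : X ⟶ Y} {g : X' ⟶ Y'}, IsRetractOf f g → Fib g → Fib f
  lifting_acof_fib : ∀ {A B X Y : C} (i : A ⟶ B) (p : X ⟶ Y),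
    Cof i → W i → Fib p → HasLiftingProperty i p
  lifting_cof_afib : ∀ {A B X Y : C} (i : A ⟶ B) (p : X ⟶ Y),
    Cof i → Fib p → W p → HasLiftingProperty i p
  fact_acof_fib : ∀ {X Y : C} (f : X ⟶ Y),
    ∃ (Z : C) (i : X ⟶ Z) (p : Z ⟶ Y), Cof i ∧ W i ∧ Fib p ∧ i ≫ p = f
  fact_cof_afib : ∀ {X Y : C} (f : X ⟶ Y),
    ∃ (Z : C) (i : X ⟶ Z) (p : Z ⟶ Y), Cof i ∧ Fib p ∧ W p ∧ i ≫ p = f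

/-- An object is cofibrant if the map from an initial object is a cofibration. -/
def Cofibrant {C : Type u} [Category.{v} C] [HasInitial C] (M : ModelStructure C) (X : C) :
    Prop := M.Cof (initial.to X)

/-- An object is fibrant if the map to a terminal object is a fibration. -/
def Fibrant {C : Type u} [Category.{v} C] [HasTerminal C] (M : ModelStructure C) (X : C) :
    Prop := M.Fib (terminal.from X)

/-- A category with a wide subcategory of weak equivalences (a relative category
whose weak equivalences form a wide subcategory). -/
structure RelCatStruct (R : Type u) [Category.{v} R] where
  W : MorphismProperty R
  W_id : ∀ X : R, W (𝟙 X)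
  W_comp : ∀ {X Y Z : R} (f : X ⟶ Y) (g : Y ⟶ Z), W f → W g → W (f ≫ g)

/-- The underlying relative category of a model structure. -/
def ModelStructure.relcat {C : Type u} [Category.{v} C] (M : ModelStructure C) :
    RelCatStruct C :=
  ⟨M.W, M.W_id, M.W_comp⟩

/-- A Quillen adjunction between model categories: an adjunction `F ⊣ G` such that
`F` preserves cofibrations and acyclic cofibrations. -/
structure QuillenAdjunction {C : Type u} {D : Type u} [Category.{v} C] [Category.{v} D]
    (MC : ModelStructure C) (MD : ModelStructure D) where
  F : C ⥤ D
  G : D ⥤ C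
  adj : F ⊣ G
  F_cof : ∀ {X Y : C} (f : X ⟶ Y), MC.Cof f → MD.Cof (F.map f)
  F_acof : ∀ {X Y : C} (f : X ⟶ Y), MC.Cof f → MC.W f → MD.W (F.map f)


variable {D : Type u} [Category.{v} D]

/-- The category `Fun_{**}(3,D)^W` of three-arrow zigzags `x ⟵ a ⟶ b ⟵ y`,
where the two backwards maps are weak equivalences; morphisms are pairs of weak
equivalences `a → a'`, `b → b'` commuting with everything and restricting to the
identity on `x` and `y`. -/
structure Zig3 (M : ModelStructure D) (x y : D) where
  a : D
  b : D
  f : a ⟶ x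
  g : a ⟶ b
  h : y ⟶ b
  hf : M.W f
  hh : M.W h

@[ext]
structure Zig3Hom {M : ModelStructure D} {x y : D} (A B : Zig3 M x y) where
  u : A.a ⟶ B.a
  v : A.b ⟶ B.b
  hu : M.W u
  hv : M.W v
  comm_f : u ≫ B.f = A.f
  comm_g : u ≫ B.g = A.g ≫ v
  comm_h : A.h ≫ v = B.h

instance {M : ModelStructure D} {x y : D} : Category (Zig3 M x y) where
  Hom := Zig3Hom
  id A := ⟨𝟙 _, 𝟙 _, M.W_id _, M.W_id _, by simp, by simp, by simp⟩
  comp φ ψ := ⟨φ.u ≫ ψ.u, φ.v ≫ ψ.v, M.W_comp _ _ φ.hu ψ.hu, M.W_comp _ _ φ.hv ψ.hv,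
    by rw [Category.assoc, ψ.comm_f, φ.comm_f],
    by rw [Category.assoc, ψ.comm_g, ← Category.assoc, φ.comm_g, Category.assoc],
    by rw [← Category.assoc, φ.comm_h, ψ.comm_h]⟩
  id_comp _ := by apply Zig3Hom.ext <;> simp
  comp_id _ := by apply Zig3Hom.ext <;> simp
  assoc _ _ _ := by apply Zig3Hom.ext <;> simp

section Homotopies

open MonoidalCategory HomotopicalAlgebra SSet.modelCategoryQuillen

/-- The inclusion of the end `ε` of the cylinder. -/
def cylIncl (X : SSet.{w}) (ε : Fin 2) : X ⟶ X ⊗ Δ[1] :=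
  CartesianMonoidalCategory.lift (𝟙 X) (constVertex X ε)

lemma sHomotopy_iff {X Y : SSet.{w}} (f g : X ⟶ Y) :
    SHomotopy f g ↔ ∃ H : X ⊗ Δ[1] ⟶ Y, cylIncl X 0 ≫ H = f ∧ cylIncl X 1 ≫ H = g := by
  let e : X ⨯ Δ[1] ⟶ X ⊗ Δ[1] := CartesianMonoidalCategory.lift prod.fst prod.snd
  let e' : X ⊗ Δ[1] ⟶ X ⨯ Δ[1] := prod.lift (SemiCartesianMonoidalCategory.fst _ _)
    (SemiCartesianMonoidalCategory.snd _ _)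
  have he (ε : Fin 2) : prod.lift (𝟙 X) (constVertex X ε) ≫ e = cylIncl X ε := by
    apply CartesianMonoidalCategory.hom_ext
    · simpa [e, cylIncl] using! prod.lift_fst _ _
    · simpa [e, cylIncl] using! prod.lift_snd _ _
  have he' (ε : Fin 2) : cylIncl X ε ≫ e' = prod.lift (𝟙 X) (constVertex X ε) := by
    ext1 <;> simp [e', cylIncl]
  constructor
  · rintro ⟨H, h0, h1⟩
    exact ⟨e' ≫ H, by rw [← Category.assoc, he', h0], by rw [← Category.assoc, he', h1]⟩
  · rintro ⟨H, h0, h1⟩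
    exact ⟨e ≫ H, by rw [← Category.assoc, he, h0], by rw [← Category.assoc, he, h1]⟩

lemma SHomotopy.precomp {X Y Z : SSet.{w}} {f g : Y ⟶ Z} (h : SHomotopy f g) (k : X ⟶ Y) :
    SHomotopy (k ≫ f) (k ≫ g) := by
  rw [sHomotopy_iff] at h ⊢
  obtain ⟨H, rfl, rfl⟩ := h
  exact ⟨k ▷ _ ≫ H, rfl, rfl⟩

lemma SHomotopy.postcomp {X Y Z : SSet.{w}} {f g : X ⟶ Y} (h : SHomotopy f g) (k : Y ⟶ Z) :
    SHomotopy (f ≫ k) (g ≫ k) := by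
  rw [sHomotopy_iff] at h ⊢
  obtain ⟨H, rfl, rfl⟩ := h
  exact ⟨H ≫ k, rfl, rfl⟩

lemma SHomotopy.htpy {X Y : SSet.{w}} {f g : X ⟶ Y} (h : SHomotopy f g) : Htpy f g :=
  Relation.EqvGen.rel _ _ h

lemma Htpy.refl {X Y : SSet.{w}} (f : X ⟶ Y) : Htpy f f := Relation.EqvGen.refl _

lemma Htpy.symm {X Y : SSet.{w}} {f g : X ⟶ Y} (h : Htpy f g) : Htpy g f :=
  Relation.EqvGen.symm _ _ h

lemma Htpy.trans {X Y : SSet.{w}} {f g h : X ⟶ Y} (h₁ : Htpy f g) (h₂ : Htpy g h) : Htpy f h :=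
  Relation.EqvGen.trans _ _ _ h₁ h₂

lemma Htpy.precomp {X Y Z : SSet.{w}} {f g : Y ⟶ Z} (h : Htpy f g) (k : X ⟶ Y) :
    Htpy (k ≫ f) (k ≫ g) := by
  induction h with
  | rel _ _ h => exact (h.precomp k).htpy
  | refl _ => exact .refl _
  | symm _ _ _ ih => exact ih.symm
  | trans _ _ _ _ _ ih₁ ih₂ => exact ih₁.trans ih₂

lemma Htpy.postcomp {X Y Z : SSet.{w}} {f g : X ⟶ Y} (h : Htpy f g) (k : Y ⟶ Z) :
    Htpy (f ≫ k) (g ≫ k) := by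
  induction h with
  | rel _ _ h => exact (h.postcomp k).htpy
  | refl _ => exact .refl _
  | symm _ _ _ ih => exact ih.symm
  | trans _ _ _ _ _ ih₁ ih₂ => exact ih₁.trans ih₂

lemma kanComplex_mathlib (K : SSet.{w}) (hK : KanComplex K) : SSet.KanComplex K := by
  rw [SSet.KanComplex.iff]
  intro n i f hf
  obtain ⟨t, ht⟩ := hf.exists_desc
  obtain ⟨σ, h⟩ := hK.hornFilling t
  exact ⟨σ, fun j hj => by rw [← ht j hj, h]; rfl⟩

/-- The functor `j ↦ Φ (θ j) j`. -/
def mix {J : Type*} [Category* J] {E : Type u} [Category.{v} E] (Φ : Fin 2 ⥤ (J ⥤ E))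
    (θ : J ⥤ Fin 2) : J ⥤ E :=
  Functor.prod' (𝟭 J) θ ⋙ Functor.uncurry.obj Φ.flip

lemma mix_const {J : Type*} [Category* J] {E : Type u} [Category.{v} E] (Φ : Fin 2 ⥤ (J ⥤ E))
    (θ : J ⥤ Fin 2) (ε : Fin 2) (hθ : ∀ j, θ.obj j = ε) : mix Φ θ = Φ.obj ε := by
  obtain rfl : θ = (Functor.const J).obj ε :=
    CategoryTheory.Functor.ext hθ (fun _ _ _ => Subsingleton.elim _ _)
  refine CategoryTheory.Functor.ext (fun _ => rfl) ?_
  intro i j f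
  change (Φ.obj ε).map _ ≫ (Φ.map (𝟙 ε)).app _ = 𝟙 _ ≫ (Φ.obj ε).map _ ≫ 𝟙 _
  rw [Φ.map_id, Category.id_comp]
  rfl

/-- The monotone map underlying a simplex of `Δ[1]`, as a functor. -/
def simplexFunctor {m : SimplexCategoryᵒᵖ} (z : (Δ[1] : SSet.{w}).obj m) :
    Fin (m.unop.len + 1) ⥤ Fin 2 :=
  (SSet.stdSimplex.asOrderHom z).monotone.functor

/-- The map from the cylinder induced by a natural transformation. -/
def cylOfNatTrans {C E : Type u} [Category.{v} C] [Category.{v} E]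
    {F G : C ⥤ E} (α : F ⟶ G) : nerve C ⊗ Δ[1] ⟶ nerve E where
  app _ := ↾fun z => mix (ComposableArrows.mk₁ α ⋙ (Functor.whiskeringLeft _ _ _).obj z.1)
    (simplexFunctor z.2)
  naturality _ _ _ := rfl

/-- The vertices of a simplex of a nerve. -/
abbrev vtx {C : Type u} [Category.{v} C] {m : SimplexCategoryᵒᵖ} (x : (nerve C).obj m)
    (j : Fin (m.unop.len + 1)) : C :=
  Functor.obj (C := Fin (m.unop.len + 1)) (D := C) x j

lemma vtx_cylOfNatTrans {C E : Type u} [Category.{v} C] [Category.{v} E]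
    {F G : C ⥤ E} (α : F ⟶ G) {m : SimplexCategoryᵒᵖ} (z : (nerve C ⊗ Δ[1]).obj m)
    (j : Fin (m.unop.len + 1)) :
    vtx ((cylOfNatTrans α).app m z) j = F.obj (vtx z.1 j) ∨
    vtx ((cylOfNatTrans α).app m z) j = G.obj (vtx z.1 j) := by
  change ((ComposableArrows.mk₁ α : Fin 2 ⥤ _).obj ((simplexFunctor z.2).obj j)).obj (vtx z.1 j)
    = _ ∨ ((ComposableArrows.mk₁ α : Fin 2 ⥤ _).obj ((simplexFunctor z.2).obj j)).obj
      (vtx z.1 j) = _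
  generalize (simplexFunctor z.2).obj j = ε
  obtain rfl | rfl : ε = 0 ∨ ε = 1 := by revert ε; decide
  · exact Or.inl rfl
  · exact Or.inr rfl

lemma cylIncl_cylOfNatTrans {C E : Type u} [Category.{v} C] [Category.{v} E]
    {F G : C ⥤ E} (α : F ⟶ G) (ε : Fin 2) :
    cylIncl (nerve C) ε ≫ cylOfNatTrans α =
      nerveMap ((ComposableArrows.mk₁ α : Fin 2 ⥤ _).obj ε) := by
  ext m c
  exact mix_const _ _ ε (fun _ => rfl)

/-- A natural transformation induces a homotopy. -/
lemma sHomotopy_of_natTrans {C E : Type u} [Category.{v} C] [Category.{v} E]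
    {F G : C ⥤ E} (α : F ⟶ G) : SHomotopy (nerveMap F) (nerveMap G) :=
  (sHomotopy_iff _ _).2 ⟨_, cylIncl_cylOfNatTrans α 0, cylIncl_cylOfNatTrans α 1⟩

lemma htpy_of_natTrans {C E : Type u} [Category.{v} C] [Category.{v} E]
    {F G : C ⥤ E} (α : F ⟶ G) : Htpy (nerveMap F) (nerveMap G) :=
  (sHomotopy_of_natTrans α).htpy

lemma stdSimplex_eq_const_of_mem_horn {m : SimplexCategoryᵒᵖ} {ε : Fin 2}
    (z : (Λ[1, ε] : SSet.{w}).obj m) :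
    z.1 = ULift.up (SimplexCategory.const m.unop ⦋1⦌ ε) := by
  obtain ⟨z, hz⟩ := z
  obtain ⟨j, hj, hz⟩ := (SSet.mem_horn_iff_notMem_range z ε).1 hz
  apply SSet.stdSimplex.objEquiv.injective
  ext k : 3
  have h1 : (SSet.stdSimplex.objEquiv z).toOrderHom k ≠ j := fun h => hz ⟨k, h⟩
  change (SSet.stdSimplex.objEquiv z).toOrderHom k = ε
  generalize (SSet.stdSimplex.objEquiv z).toOrderHom k = t at h1
  clear hz
  have key : ∀ j ε t : Fin 2, j ≠ ε → t ≠ j → t = ε := by decide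
  exact key j ε t hj h1

/-- The homotopy extension property of a monomorphism with respect to a Kan complex. -/
lemma exists_homotopy_extension {A X K : SSet.{w}} [SSet.KanComplex K] (i : A ⟶ X) [Mono i]
    (H : A ⊗ Δ[1] ⟶ K) (ε : Fin 2) (χ : X ⟶ K) (hχ : i ≫ χ = cylIncl A ε ≫ H) :
    ∃ H' : X ⊗ Δ[1] ⟶ K, i ▷ Δ[1] ≫ H' = H := by
  have hfib : Fibration ((MonoidalClosed.pre i).app K) := inferInstance
  rw [SSet.modelCategoryQuillen.fibration_iff] at hfib
  have hl : HasLiftingProperty (Λ[1, ε] : Subfunctor _).ι ((MonoidalClosed.pre i).app K) := by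
    exact hfib _ (SSet.modelCategoryQuillen.horn_ι_mem_J 1 ε)
  have sq : CommSq
      (MonoidalClosed.curry (SemiCartesianMonoidalCategory.fst X (Λ[1, ε] : SSet.{w}) ≫ χ))
      (Λ[1, ε] : Subfunctor _).ι ((MonoidalClosed.pre i).app K) (MonoidalClosed.curry H) := by
    constructor
    rw [MonoidalClosed.curry_pre_app, ← MonoidalClosed.curry_natural_left]
    congr 1
    ext m ⟨a, z⟩
    have h1 := ConcreteCategory.congr_hom (NatTrans.congr_app hχ m) a
    change χ.app m (i.app m a) = H.app m (a, z.1)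
    rw [stdSimplex_eq_const_of_mem_horn z]
    exact h1
  refine ⟨MonoidalClosed.uncurry sq.lift, ?_⟩
  apply MonoidalClosed.curry_injective
  rw [← MonoidalClosed.curry_pre_app, MonoidalClosed.curry_uncurry, sq.fac_right]

/-- Homotopic maps into a Kan complex extend along a monomorphism simultaneously. -/
lemma SHomotopy.exists_extension_iff {A X K : SSet.{w}} [SSet.KanComplex K] (i : A ⟶ X) [Mono i]
    {f g : A ⟶ K} (h : SHomotopy f g) :
    (∃ f' : X ⟶ K, i ≫ f' = f) ↔ ∃ g' : X ⟶ K, i ≫ g' = g := by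
  rw [sHomotopy_iff] at h
  obtain ⟨H, rfl, rfl⟩ := h
  constructor
  · rintro ⟨f', hf'⟩
    obtain ⟨H', hH'⟩ := exists_homotopy_extension i H 0 f' hf'
    exact ⟨cylIncl X 1 ≫ H', by rw [← hH']; rfl⟩
  · rintro ⟨f', hf'⟩
    obtain ⟨H', hH'⟩ := exists_homotopy_extension i H 1 f' hf'
    exact ⟨cylIncl X 0 ≫ H', by rw [← hH']; rfl⟩

end Homotopies

section Collage

universe u₁ u₂ u₃

/-- The collage of `c : I ⥤ C` and `F : S ⥤ C`: the disjoint union of `I` and `S`, where a morphism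
from `i` to `a` is a morphism `c i ⟶ F a` in `C`. -/
inductive Coll {I : Type u₁} [Preorder I] {C : Type u₂} [Category.{v} C] {S : Type u₃}
    [Category.{v} S] (c : I ⥤ C) (F : S ⥤ C) : Type (max u₁ u₃) where
  | inl (i : I)
  | inr (a : S)

lemma _root_.CategoryTheory.Functor.map_comp_map_comp_eq {I : Type u₁} [Preorder I] {C : Type u₂}
    [Category.{v} C] (c : I ⥤ C) {i j j' k : I} {X : C} (p : i ⟶ j) (q : j ⟶ k) (g : c.obj k ⟶ X)
    (p' : i ⟶ j') (q' : j' ⟶ k) : c.map p ≫ c.map q ≫ g = c.map p' ≫ c.map q' ≫ g := by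
  rw [← Category.assoc, ← Category.assoc, ← c.map_comp, ← c.map_comp]
  rfl

namespace Coll

variable {I : Type u₁} [Preorder I] {C : Type u₂} [Category.{v} C] {S : Type u₃}
    [Category.{v} S] {c : I ⥤ C} {F : S ⥤ C}

/-- Morphisms of the collage. -/
def Hom (X Y : Coll c F) : Type v := match X, Y with
  | inl i, inl j => ULift (PLift (i ≤ j))
  | inl i, inr a => c.obj i ⟶ F.obj a
  | inr _, inl _ => PEmpty
  | inr a, inr b => a ⟶ b

/-- Composition in the collage. -/
def comp {X Y Z : Coll c F} (f : Hom X Y) (g : Hom Y Z) : Hom X Z := match X, Y, Z, f, g with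
  | inl _, inl _, inl _, f, g => ⟨⟨f.down.down.trans g.down.down⟩⟩
  | inl _, inl _, inr _, f, g => c.map (homOfLE f.down.down) ≫ (show c.obj _ ⟶ F.obj _ from g)
  | inl _, inr _, inl _, _, g => g.elim
  | inl _, inr _, inr _, f, g => (show c.obj _ ⟶ F.obj _ from f) ≫ F.map g
  | inr _, inl _, _, f, _ => f.elim
  | inr _, inr _, inl _, _, g => g.elim
  | inr _, inr _, inr _, f, g => (show _ ⟶ _ from f) ≫ (show _ ⟶ _ from g)

instance : Category.{v} (Coll c F) where
  Hom := Hom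
  id X := match X with
    | inl i => ⟨⟨le_refl i⟩⟩
    | inr a => 𝟙 a
  comp := comp
  id_comp {X Y} f := by
    cases X <;> cases Y
    · rfl
    · exact (congrArg (· ≫ _) (c.map_id _)).trans (Category.id_comp _)
    · exact f.elim
    · exact Category.id_comp _
  comp_id {X Y} f := by
    cases X <;> cases Y
    · rfl
    · exact (congrArg (_ ≫ ·) (F.map_id _)).trans (Category.comp_id _)
    · exact f.elim
    · exact Category.comp_id _
  assoc {X Y Z W} f g h := by
    cases X <;> cases Y <;> try exact PEmpty.elim f
    all_goals cases Z <;> try exact PEmpty.elim g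
    all_goals cases W <;> try exact PEmpty.elim h
    · rfl
    · exact (congrArg (· ≫ _) (c.map_comp _ _)).trans (Category.assoc _ _ _)
    · exact Category.assoc _ _ _
    · exact (Category.assoc _ _ _).trans (congrArg (_ ≫ ·) (F.map_comp _ _).symm)
    · exact Category.assoc _ _ _

/-- The morphism between indices. -/
abbrev ofLE {i j : I} (h : i ≤ j) : (inl i : Coll c F) ⟶ inl j := (⟨⟨h⟩⟩ : ULift (PLift (i ≤ j)))

/-- The mixed morphisms. -/
abbrev ofHom {i : I} {a : S} (f : c.obj i ⟶ F.obj a) : (inl i : Coll c F) ⟶ inr a := f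

/-- The morphisms between objects of `S`. -/
abbrev ofRight {a b : S} (f : a ⟶ b) : (inr a : Coll c F) ⟶ inr b := f

variable {E : Type*} [Category* E]

/-- A functor from the collage on objects. -/
def descObj (a : I ⥤ E) (b : S ⥤ E) (X : Coll c F) : E := match X with
  | inl i => a.obj i
  | inr q => b.obj q

/-- A functor from the collage on morphisms. -/
def descMap (a : I ⥤ E) (b : S ⥤ E)
    (t : ∀ {i : I} {q : S} (_ : c.obj i ⟶ F.obj q), a.obj i ⟶ b.obj q)
    {X Y : Coll c F} (f : Hom X Y) : descObj a b X ⟶ descObj a b Y := match X, Y, f with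
  | inl _, inl _, f => a.map (homOfLE f.down.down)
  | inl _, inr _, f => t f
  | inr _, inl _, f => f.elim
  | inr _, inr _, f => b.map f

/-- Functors from the collage. -/
def desc (a : I ⥤ E) (b : S ⥤ E)
    (t : ∀ {i : I} {q : S} (_ : c.obj i ⟶ F.obj q), a.obj i ⟶ b.obj q)
    (ht₁ : ∀ {i j : I} {q : S} (h : i ≤ j) (f : c.obj j ⟶ F.obj q),
      t (c.map (homOfLE h) ≫ f) = a.map (homOfLE h) ≫ t f)
    (ht₂ : ∀ {i : I} {q r : S} (f : c.obj i ⟶ F.obj q) (g : q ⟶ r),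
      t (f ≫ F.map g) = t f ≫ b.map g) : Coll c F ⥤ E where
  obj := descObj a b
  map := descMap a b t
  map_id X := by
    cases X
    · exact a.map_id _
    · exact b.map_id _
  map_comp {X Y Z} f g := by
    cases X <;> cases Y <;> try exact PEmpty.elim f
    all_goals cases Z <;> try exact PEmpty.elim g
    · exact a.map_comp _ _
    · exact ht₁ _ _
    · exact ht₂ _ _
    · exact b.map_comp _ _

/-- The inclusion of the index category. -/
def inlF (c : I ⥤ C) (F : S ⥤ C) : I ⥤ Coll c F where
  obj i := inl i
  map f := ofLE (leOfHom f)

/-- The inclusion of `S`. -/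
def inrF (c : I ⥤ C) (F : S ⥤ C) : S ⥤ Coll c F where
  obj a := inr a
  map f := f

variable {J : Type*} [Preorder J]

/-- Reindexing of the collage. -/
def reindex (θ : J ⥤ I) (c : I ⥤ C) (F : S ⥤ C) : Coll (θ ⋙ c) F ⥤ Coll c F :=
  desc (θ ⋙ inlF c F) (inrF c F) (fun f => ofHom f) (fun _ _ => rfl) (fun _ _ => rfl)

lemma reindex_id (c : I ⥤ C) (F : S ⥤ C) : reindex (𝟭 I) c F = 𝟭 _ := by
  refine Functor.hext (fun X => by cases X <;> rfl) ?_
  rintro (_ | _) (_ | _) f <;> first | rfl | exact PEmpty.elim f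

lemma reindex_comp {J' : Type*} [Preorder J'] (θ' : J' ⥤ J) (θ : J ⥤ I) (c : I ⥤ C) (F : S ⥤ C) :
    reindex (θ' ⋙ θ) c F = reindex θ' (θ ⋙ c) F ⋙ reindex θ c F := by
  refine Functor.hext (fun X => by cases X <;> rfl) ?_
  rintro (_ | _) (_ | _) f <;> first | rfl | exact PEmpty.elim f

/-- The canonical functor from the collage to `C`. -/
def toBase (c : I ⥤ C) (F : S ⥤ C) : Coll c F ⥤ C :=
  desc c F (fun f => f) (fun _ _ => rfl) (fun _ _ => rfl)

lemma reindex_toBase (θ : J ⥤ I) (c : I ⥤ C) (F : S ⥤ C) :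
    reindex θ c F ⋙ toBase c F = toBase (θ ⋙ c) F := by
  refine Functor.hext (fun X => by cases X <;> rfl) ?_
  rintro (_ | _) (_ | _) f <;> first | rfl | exact PEmpty.elim f

/-! Lifting chains along a reindexing -/

/-- The object part of a lift along a reindexing. -/
def liftObj (s : J ⥤ I) (j : J) (X : Coll c F) : Coll (s ⋙ c) F := match X with
  | inl _ => inl j
  | inr a => inr a

/-- The morphism part of a lift along a reindexing. -/
def liftMap (s : J ⥤ I) {j j' : J} (hj : j ≤ j') {X Y : Coll c F}
    (h : ∀ i, X = inl i → s.obj j ≤ i) (f : X ⟶ Y) : liftObj s j X ⟶ liftObj s j' Y :=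
  match X, Y, h, f with
  | inl _, inl _, _, _ => ofLE hj
  | inl i, inr _, h, f => ofHom (c := s ⋙ c) (c.map (homOfLE (h i rfl)) ≫ f)
  | inr _, inl _, _, f => PEmpty.elim f
  | inr _, inr _, _, f => f

lemma liftMap_id (s : J ⥤ I) (j : J) (X : Coll c F) (h : ∀ i, X = inl i → s.obj j ≤ i) :
    liftMap s le_rfl h (𝟙 X) = 𝟙 (liftObj s j X) := by
  cases X <;> rfl

lemma liftMap_comp (s : J ⥤ I) {j j' j'' : J} (hj : j ≤ j') (hj' : j' ≤ j'') {X Y Z : Coll c F}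
    (hX : ∀ i, X = inl i → s.obj j ≤ i) (hY : ∀ i, Y = inl i → s.obj j' ≤ i)
    (f : X ⟶ Y) (g : Y ⟶ Z) :
    liftMap s (hj.trans hj') hX (f ≫ g) = liftMap s hj hX f ≫ liftMap s hj' hY g := by
  cases X <;> cases Y <;> try exact PEmpty.elim f
  all_goals cases Z <;> try exact PEmpty.elim g
  · rfl
  · exact c.map_comp_map_comp_eq _ _ _ (s.map (homOfLE hj)) _
  · exact (Category.assoc _ _ _).symm
  · rfl

/-- The lift of a functor into a collage along a reindexing. -/
def lift (z : J ⥤ Coll c F) (s : J ⥤ I) (h : ∀ j i, z.obj j = inl i → s.obj j ≤ i) :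
    J ⥤ Coll (s ⋙ c) F where
  obj j := liftObj s j (z.obj j)
  map {j j'} f := liftMap s (leOfHom f) (h j) (z.map f)
  map_id j := by
    simp only [z.map_id]
    exact liftMap_id s j _ _
  map_comp {j j' j''} f g := by
    simp only [z.map_comp]
    exact liftMap_comp s (leOfHom f) (leOfHom g) _ _ _ _

lemma lift_reindex (z : J ⥤ Coll c F) (s : J ⥤ I) (h : ∀ j i, z.obj j = inl i → s.obj j = i) :
    lift z s (fun j i hi => (h j i hi).le) ⋙ reindex s c F = z := by
  have hobj : ∀ (X : Coll c F) (j : J), (∀ i, X = inl i → s.obj j = i) →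
      (reindex s c F).obj (liftObj s j X) = X := by
    rintro (i | _) j h
    · obtain rfl := h i rfl
      rfl
    · rfl
  have hmap : ∀ (X Y : Coll c F) (j j' : J) (hj : j ≤ j') (hX : ∀ i, X = inl i → s.obj j = i)
      (_ : ∀ i, Y = inl i → s.obj j' = i) (f : X ⟶ Y),
      HEq ((reindex s c F).map (liftMap s hj (fun i hi => (hX i hi).le) f)) f := by
    rintro (i | _) (i' | _) j j' hj hX hY f
    · obtain rfl := hX i rfl
      obtain rfl := hY i' rfl
      rfl
    · obtain rfl := hX i rfl
      refine heq_of_eq ?_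
      exact (congrArg (· ≫ _) (c.map_id _)).trans (Category.id_comp _)
    · exact PEmpty.elim f
    · rfl
  exact Functor.hext (fun j => hobj _ _ (h j)) (fun j j' f => hmap _ _ _ _ _ (h j) (h j') _)

lemma lift_comp_reindex {K : Type*} [Preorder K] (s : K ⥤ J) (θ : J ⥤ I)
    (z : K ⥤ Coll (θ ⋙ c) F) (h : ∀ j i, z.obj j = inl i → s.obj j ≤ i)
    (h' : ∀ j i, (z ⋙ reindex θ c F).obj j = inl i → (s ⋙ θ).obj j ≤ i) :
    lift (z ⋙ reindex θ c F) (s ⋙ θ) h' = lift z s h := by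
  have hobj : ∀ (X : Coll (θ ⋙ c) F) (j : K),
      liftObj (c := c) (s ⋙ θ) j ((reindex θ c F).obj X) = liftObj (c := θ ⋙ c) s j X := by
    rintro (i | _) j <;> rfl
  have hmap : ∀ (X Y : Coll (θ ⋙ c) F) (j j' : K) (hj : j ≤ j')
      (hX : ∀ i, (reindex θ c F).obj X = inl i → (s ⋙ θ).obj j ≤ i)
      (hX' : ∀ i, X = inl i → s.obj j ≤ i) (f : X ⟶ Y),
      HEq (liftMap (c := c) (s ⋙ θ) hj hX ((reindex θ c F).map f))
        (liftMap (c := θ ⋙ c) s hj hX' f) := by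
    rintro (i | _) (i' | _) j j' hj hX hX' f
    · rfl
    · rfl
    · exact PEmpty.elim f
    · rfl
  exact Functor.hext (fun j => hobj _ _) (fun j j' f => hmap _ _ _ _ _ _ _ _)

end Coll

end Collage

section Extension

open MonoidalCategory

/-- A natural functional relation between simplicial sets is the graph of a morphism. -/
lemma exists_hom_of_rel {X K : SSet.{w}} (R : ∀ m, X.obj m → K.obj m → Prop)
    (htot : ∀ m x, ∃ k, R m x k) (hfun : ∀ m x k k', R m x k → R m x k' → k = k')
    (hnat : ∀ {m m'} (f : m ⟶ m') x k, R m x k → R m' (X.map f x) (K.map f k)) :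
    ∃ ψ : X ⟶ K, ∀ m x, R m x (ψ.app m x) := by
  choose k hk using htot
  refine ⟨{ app := fun m => ↾(k m), naturality := ?_ }, hk⟩
  intro m m' f
  ext x
  exact hfun _ _ _ _ (hk _ _) (hnat f x _ (hk _ _))

namespace Coll

section Miss

variable {n : ℕ} {C : Type u₂} [Category.{v} C] {S : Type u} [Category.{v} S]
  {c : Fin (n + 1) ⥤ C} {F : S ⥤ C}

/-- The simplices of the nerve of a collage which miss an index. -/
def miss (c : Fin (n + 1) ⥤ C) (F : S ⥤ C) :
    (nerve (Coll c F)).Subcomplex where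
  obj m := {z | ∃ i, ∀ j, vtx z j ≠ inl i}
  map {m m'} f z := by
    rintro ⟨i, hi⟩
    exact ⟨i, fun j => hi _⟩

/-- An endofunctor which does not create indices preserves simplices missing an index. -/
def missMap (T : Coll c F ⥤ Coll c F) (hT : ∀ X i, T.obj X = inl i → X = inl i) :
    (miss c F : SSet) ⟶ miss c F :=
  SSet.Subcomplex.lift ((miss c F).ι ≫ nerveMap T) (by
    rintro m _ ⟨⟨z, i, hi⟩, rfl⟩
    exact ⟨i, fun j h => hi j (hT _ _ h)⟩)

lemma sHomotopy_missMap {T T' : Coll c F ⥤ Coll c F} (a : T ⟶ T')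
    (hT : ∀ X i, T.obj X = inl i → X = inl i) (hT' : ∀ X i, T'.obj X = inl i → X = inl i) :
    SHomotopy (missMap T hT) (missMap T' hT') := by
  rw [sHomotopy_iff]
  refine ⟨SSet.Subcomplex.lift ((miss c F).ι ▷ Δ[1] ≫ cylOfNatTrans a) ?_, ?_, ?_⟩
  · rintro m _ ⟨⟨⟨z, i, hi⟩, t⟩, rfl⟩
    refine ⟨i, fun j h => hi j ?_⟩
    obtain h' | h' := vtx_cylOfNatTrans a (m := m) (z, t) j
    · exact hT _ _ (h'.symm.trans h)
    · exact hT' _ _ (h'.symm.trans h)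
  · rw [← cancel_mono (miss c F).ι]
    exact congrArg ((miss c F).ι ≫ ·) (cylIncl_cylOfNatTrans a 0)
  · rw [← cancel_mono (miss c F).ι]
    exact congrArg ((miss c F).ι ≫ ·) (cylIncl_cylOfNatTrans a 1)

end Miss

/-- The join of `Fin (n + 1)` and `L`. -/
abbrev Join (n : ℕ) (L : Type u) [Category.{v} L] : Type u :=
  Coll (Functor.star.{v} (Fin (n + 1))) (Functor.star.{v} L)

namespace Join

variable {n : ℕ} {L : Type u} [Category.{v} L]

/-- The morphism from an index to an object of `L`. -/
def mixed (i : Fin (n + 1)) (l : L) : (inl i : Join n L) ⟶ inr l :=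
  ofHom (eqToHom (Subsingleton.elim _ _))

lemma mixed_ext {i : Fin (n + 1)} {l : L} (f g : (inl i : Join n L) ⟶ inr l) : f = g :=
  Subsingleton.elim (α := (Functor.star.{v} _).obj i ⟶ (Functor.star.{v} _).obj l) _ _

/-- The endofunctor of the join induced by an endofunctor of `L`. -/
def map (P : L ⥤ L) : Join n L ⥤ Join n L :=
  desc (inlF _ _) (P ⋙ inrF _ _) (fun _ => mixed _ _) (fun _ _ => mixed_ext _ _)
    (fun _ _ => mixed_ext _ _)

/-- The natural transformation between endofunctors of the join induced by a natural
transformation. -/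
def mapNat {P P' : L ⥤ L} (a : P ⟶ P') : (map P : Join n L ⥤ Join n L) ⟶ map P' where
  app X := match X with
    | inl i => 𝟙 (inl i)
    | inr l => ofRight (a.app l)
  naturality X Y f := by
    cases X <;> cases Y <;> try exact PEmpty.elim f
    · rfl
    · exact mixed_ext _ _
    · exact a.naturality f

/-- The natural transformation from an endofunctor of the join to a constant functor. -/
def mapConst (b : L) : (map ((Functor.const L).obj b) : Join n L ⥤ Join n L) ⟶
    (Functor.const _).obj (inr b) where
  app X := match X with
    | inl i => mixed i b
    | inr l => 𝟙 (inr b)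
  naturality X Y f := by
    cases X <;> cases Y <;> try exact PEmpty.elim f
    · exact mixed_ext _ _
    · exact mixed_ext _ _
    · rfl

lemma map_id : (map (𝟭 L) : Join n L ⥤ Join n L) = 𝟭 _ := by
  refine Functor.hext (fun X => by cases X <;> rfl) ?_
  rintro (_ | _) (_ | _) f
  · rfl
  · exact heq_of_eq (mixed_ext _ _)
  · exact PEmpty.elim f
  · rfl

lemma map_obj_eq_inl (P : L ⥤ L) (X : Join n L) (i : Fin (n + 1)) (h : (map P).obj X = inl i) :
    X = inl i := by
  cases X
  · exact h
  · cases h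

/-- If `L` is contractible via a zigzag `𝟭 ⟵ P ⟶ b`, then maps into Kan complexes extend from the
simplices of the nerve of the join of `Fin (n + 1)` and `L` missing an index. -/
lemma exists_extension (P : L ⥤ L) (b : L)
    (p : P ⟶ 𝟭 L) (q : P ⟶ (Functor.const L).obj b) {K : SSet.{max u v}} [SSet.KanComplex K]
    (χ : (miss (Functor.star.{v} (Fin (n + 1))) (Functor.star.{v} L) : SSet) ⟶ K) :
    ∃ ψ : nerve (Join n L) ⟶ K, (miss _ _).ι ≫ ψ = χ := by
  have h₁ := (sHomotopy_missMap (mapNat p) (map_obj_eq_inl (n := n) _) (map_obj_eq_inl _)).postcomp χ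
  have h₂ := (sHomotopy_missMap (mapNat q ≫ mapConst b) (map_obj_eq_inl (n := n) _)
    (fun X i h => by cases h)).postcomp χ
  have h₃ : missMap (map (𝟭 L)) (map_obj_eq_inl (n := n) _) = 𝟙 _ := by
    rw [← cancel_mono (miss _ _).ι]
    change (miss _ _).ι ≫ nerveMap (map (𝟭 L)) = _
    rw [map_id]
    rfl
  rw [h₃, Category.id_comp] at h₁
  rw [← h₁.exists_extension_iff (miss _ _).ι, h₂.exists_extension_iff (miss _ _).ι]
  exact ⟨SSet.Subcomplex.lift (nerveMap ((Functor.const _).obj (inr b)))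
    (by rintro m _ ⟨z, rfl⟩; exact ⟨0, fun j h => by cases h⟩) ≫ χ, rfl⟩

end Join

end Coll

end Extension

section Extension

lemma _root_.CategoryTheory.Functor.exists_lift_of_faithful {J : Type*} [Category* J] {V : Type*}
    [Category* V] {E : Type*} [Category* E] (G : V ⥤ E) [G.Faithful] (z : J ⥤ E) (W : J → V)
    (hW : ∀ j, G.obj (W j) = z.obj j)
    (h : ∀ {j j'} (f : j ⟶ j'), ∃ g : W j ⟶ W j', HEq (G.map g) (z.map f)) :
    ∃ w : J ⥤ V, (∀ j, w.obj j = W j) ∧ w ⋙ G = z := by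
  obtain ⟨zo, zm, hid, hcomp⟩ := z
  obtain rfl : (fun j => G.obj (W j)) = zo := funext hW
  simp only [heq_eq_eq] at h
  choose g hg using @h
  refine ⟨{ obj := W, map := g, map_id := ?_, map_comp := ?_ }, fun _ => rfl, ?_⟩
  · intro j
    apply G.map_injective
    rw [hg, G.map_id]
    exact hid j
  · intro j j' j'' f f'
    apply G.map_injective
    rw [hg, G.map_comp, hg, hg]
    exact hcomp f f'
  · refine Functor.hext (fun _ => rfl) (fun j j' f => heq_of_eq (hg f))

namespace Coll

variable {n : ℕ} {C : Type u} [Category.{v} C] {S : Type u} [Category.{v} S]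
  (c : Fin (n + 1) ⥤ C) (F : S ⥤ C)

/-- The functor from the join of `Fin (n + 1)` and the slice under the last vertex. -/
def ofJoin : Join n (StructuredArrow (c.obj (Fin.last n)) F) ⥤ Coll c F :=
  desc (inlF c F) (StructuredArrow.proj _ _ ⋙ inrF c F)
    (fun {i l} _ => ofHom (c.map (homOfLE (Fin.le_last i)) ≫ l.hom))
    (fun {i j l} h _ => by
      change _ = c.map (homOfLE h) ≫ c.map _ ≫ l.hom
      rw [← Category.assoc, ← c.map_comp]
      rfl)
    (fun {i l l'} _ g => by
      change _ = (c.map _ ≫ l.hom) ≫ F.map g.right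
      rw [Category.assoc, StructuredArrow.w]
      rfl)

lemma ofJoin_obj_eq_inl (X : Join n (StructuredArrow (c.obj (Fin.last n)) F)) (i : Fin (n + 1)) :
    (ofJoin c F).obj X = inl i ↔ X = inl i := by
  cases X
  · change inl _ = inl _ ↔ inl _ = inl _
    simp
  · constructor <;> intro h <;> cases h

instance : (ofJoin c F).Faithful where
  map_injective {X Y} f g h := by
    cases X <;> cases Y <;> try exact PEmpty.elim f
    · exact h
    · exact Join.mixed_ext _ _
    · exact StructuredArrow.ext _ _ h

variable {c F}

lemma ofJoin_unique_aux {X₀ X X₀' X' : Join n (StructuredArrow (c.obj (Fin.last n)) F)}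
    (f : X₀ ⟶ X) (f' : X₀' ⟶ X') (h : X₀ = inl (Fin.last n)) (h' : X₀' = inl (Fin.last n))
    (hX : (ofJoin c F).obj X = (ofJoin c F).obj X')
    (hf : HEq ((ofJoin c F).map f) ((ofJoin c F).map f')) : X = X' := by
  subst h h'
  cases X <;> cases X'
  · cases hX
    rfl
  · cases hX
  · cases hX
  · rename_i l l'
    obtain ⟨⟨⟩, r, p⟩ := l
    obtain ⟨⟨⟩, r', p'⟩ := l'
    cases hX
    have hf := eq_of_heq hf
    change c.map (𝟙 _) ≫ p = c.map (𝟙 _) ≫ p' at hf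
    rw [c.map_id] at hf
    simp only [Category.id_comp] at hf
    rw [hf]

lemma ofJoin_heq {X Y X' Y' : Join n (StructuredArrow (c.obj (Fin.last n)) F)}
    (f : X ⟶ Y) (f' : X' ⟶ Y') (hX : X = X') (hY : Y = Y')
    (hf : HEq ((ofJoin c F).map f) ((ofJoin c F).map f')) : HEq f f' := by
  subst hX hY
  exact heq_of_eq ((ofJoin c F).map_injective (eq_of_heq hf))

lemma eq_of_heq_map {J E : Type*} [Category* J] [Category* E] {w w' : J ⥤ E} (h : w = w') {j j' : J}
    (f : j ⟶ j') : HEq (w.map f) (w'.map f) := by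
  subst h; rfl

lemma ofJoin_unique {J : Type*} [LinearOrder J]
    (w w' : J ⥤ Join n (StructuredArrow (c.obj (Fin.last n)) F))
    (h : w ⋙ ofJoin c F = w' ⋙ ofJoin c F) (j₀ : J) (hj₀ : w.obj j₀ = inl (Fin.last n)) :
    w = w' := by
  have hob (j : J) : (ofJoin c F).obj (w.obj j) = (ofJoin c F).obj (w'.obj j) :=
    congrArg (fun z : J ⥤ _ => z.obj j) h
  have hj₀' : w'.obj j₀ = inl (Fin.last n) := by
    have := hob j₀
    rw [hj₀] at this
    exact (ofJoin_obj_eq_inl c F _ _).1 this.symm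
  have hob' (j : J) : w.obj j = w'.obj j := by
    obtain hj | hj := le_total j₀ j
    · exact ofJoin_unique_aux (w.map (homOfLE hj)) (w'.map (homOfLE hj)) hj₀ hj₀' (hob j)
        (eq_of_heq_map h _)
    · have f := w.map (homOfLE hj)
      rw [hj₀] at f
      have := hob j
      generalize w.obj j = X at *
      cases X
      · exact ((ofJoin_obj_eq_inl c F _ _).1 this.symm).symm
      · exact PEmpty.elim f
  exact Functor.hext hob' (fun j j' f => ofJoin_heq _ _ (hob' j) (hob' j') (eq_of_heq_map h f))

lemma exists_ofJoin_obj {X₀ X : Coll c F} (f : X₀ ⟶ X) (h₀ : X₀ = inl (Fin.last n)) :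
    ∃ (W : Join n (StructuredArrow (c.obj (Fin.last n)) F)) (g : inl (Fin.last n) ⟶ W),
      (ofJoin c F).obj W = X ∧ HEq ((ofJoin c F).map g) f := by
  subst h₀
  cases X with
  | inl i => exact ⟨inl i, ofLE f.down.down, rfl, HEq.rfl⟩
  | inr a =>
    refine ⟨inr (StructuredArrow.mk (show c.obj _ ⟶ F.obj a from f)), Join.mixed _ _, rfl,
      heq_of_eq ?_⟩
    exact (congrArg (· ≫ _) (c.map_id _)).trans (Category.id_comp _)

lemma exists_ofJoin_map {X₀ W W' : Join n (StructuredArrow (c.obj (Fin.last n)) F)}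
    (h₀ : X₀ = inl (Fin.last n)) (f : X₀ ⟶ W) (f' : X₀ ⟶ W')
    (g : (ofJoin c F).obj W ⟶ (ofJoin c F).obj W')
    (h : (ofJoin c F).map f' = (ofJoin c F).map f ≫ g) : ∃ g' : W ⟶ W', (ofJoin c F).map g' = g := by
  subst h₀
  cases W with
  | inl i =>
    cases W' with
    | inl j => exact ⟨g, rfl⟩
    | inr l =>
      obtain rfl : i = Fin.last n := le_antisymm (Fin.le_last _) f.down.down
      obtain rfl : f = 𝟙 _ := rfl
      rw [(ofJoin c F).map_id, Category.id_comp] at h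
      exact ⟨f', h⟩
  | inr l =>
    cases W' with
    | inl j => exact PEmpty.elim g
    | inr l' =>
      refine ⟨ofRight (StructuredArrow.homMk (show l.right ⟶ l'.right from g) ?_), rfl⟩
      change c.map (𝟙 _) ≫ l'.hom = (c.map (𝟙 _) ≫ l.hom) ≫ F.map _ at h
      rw [c.map_id] at h
      simp only [Category.id_comp] at h
      exact h.symm

lemma exists_ofJoin_map_of_eq_inl {W W' : Join n (StructuredArrow (c.obj (Fin.last n)) F)}
    (g : (ofJoin c F).obj W ⟶ (ofJoin c F).obj W') {i : Fin (n + 1)} (hW' : W' = inl i) :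
    (∃ i', W = inl i') ∧ ∃ g' : W ⟶ W', (ofJoin c F).map g' = g := by
  subst hW'
  cases W with
  | inl i' => exact ⟨⟨i', rfl⟩, g, rfl⟩
  | inr l => exact PEmpty.elim g

lemma exists_ofJoin_map_of_heq {X Y W : Join n (StructuredArrow (c.obj (Fin.last n)) F)}
    (h : Y = X) (g : X ⟶ W) (f : (ofJoin c F).obj Y ⟶ (ofJoin c F).obj W)
    (hg : HEq ((ofJoin c F).map g) f) : ∃ g' : Y ⟶ W, (ofJoin c F).map g' = f := by
  subst h
  exact ⟨g, eq_of_heq hg⟩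

lemma exists_ofJoin {J : Type*} [LinearOrder J] (z : J ⥤ Coll c F) (j₀ : J)
    (hj₀ : z.obj j₀ = inl (Fin.last n)) :
    ∃ w : J ⥤ Join n (StructuredArrow (c.obj (Fin.last n)) F), w ⋙ ofJoin c F = z := by
  have key (j : J) : ∃ W : Join n (StructuredArrow (c.obj (Fin.last n)) F),
      (ofJoin c F).obj W = z.obj j ∧
      ∀ h : j₀ ≤ j, ∃ g : inl (Fin.last n) ⟶ W, HEq ((ofJoin c F).map g) (z.map (homOfLE h)) := by
    by_cases h : j₀ ≤ j
    · obtain ⟨W, g, hW, hg⟩ := exists_ofJoin_obj (z.map (homOfLE h)) hj₀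
      exact ⟨W, hW, fun _ => ⟨g, hg⟩⟩
    · have f := z.map (homOfLE (le_of_not_ge h))
      rw [hj₀] at f
      obtain ⟨i, hi⟩ : ∃ i, z.obj j = inl i := by
        generalize z.obj j = X at f
        cases X with
        | inl i => exact ⟨i, rfl⟩
        | inr a => exact PEmpty.elim f
      exact ⟨inl i, hi.symm, fun h' => (h h').elim⟩
  choose W hW hWg using key
  obtain ⟨w, -, hw⟩ := (ofJoin c F).exists_lift_of_faithful z W hW (by
    obtain ⟨zo, zm, hid, hcomp⟩ := z
    obtain rfl : (fun j => (ofJoin c F).obj (W j)) = zo := funext hW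
    replace hj₀ := (ofJoin_obj_eq_inl c F _ _).1 hj₀
    simp only at hWg
    have hB (j : J) (h : j₀ ≤ j) : ∃ g : W j₀ ⟶ W j, (ofJoin c F).map g = zm (homOfLE h) := by
      obtain ⟨g, hg⟩ := hWg j h
      exact exists_ofJoin_map_of_heq hj₀ g _ hg
    intro j j' f
    simp only [heq_eq_eq]
    obtain hj | hj := le_total j₀ j
    · obtain ⟨g, hg⟩ := hB j hj
      obtain ⟨g', hg'⟩ := hB j' (hj.trans (leOfHom f))
      exact exists_ofJoin_map hj₀ g g' _ (by rw [hg, hg']; exact hcomp (homOfLE hj) f)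
    · obtain hj' | hj' := le_total j₀ j'
      · obtain ⟨g, hg⟩ := (exists_ofJoin_map_of_eq_inl (zm (homOfLE hj)) hj₀).2
        obtain ⟨g', hg'⟩ := hB j' hj'
        refine ⟨g ≫ g', ?_⟩
        rw [Functor.map_comp, hg, hg']
        exact (hcomp (homOfLE hj) (homOfLE hj')).symm
      · obtain ⟨i, hi⟩ := (exists_ofJoin_map_of_eq_inl (zm (homOfLE hj')) hj₀).1
        exact (exists_ofJoin_map_of_eq_inl _ hi).2)
  exact ⟨w, hw⟩

/-- Maps into Kan complexes extend from the simplices of the nerve of a collage missing an index,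
if the slice under the last vertex is contractible via a zigzag `𝟭 ⟵ P ⟶ b`. -/
lemma exists_extension (P : StructuredArrow (c.obj (Fin.last n)) F ⥤ _)
    (b : StructuredArrow (c.obj (Fin.last n)) F) (p : P ⟶ 𝟭 _) (q : P ⟶ (Functor.const _).obj b)
    {K : SSet.{max u v}} [SSet.KanComplex K] (χ : (miss c F : SSet) ⟶ K) :
    ∃ ψ : nerve (Coll c F) ⟶ K, (miss c F).ι ≫ ψ = χ := by
  let r : (miss (Functor.star.{v} (Fin (n + 1))) (Functor.star.{v} _) : SSet.{max u v}) ⟶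
      (miss c F : SSet.{max u v}) :=
    { app := fun m => ↾fun z => ⟨z.1 ⋙ ofJoin c F, z.2.imp fun i hi j h =>
        hi j ((ofJoin_obj_eq_inl c F _ _).1 h)⟩
      naturality := fun _ _ _ => rfl }
  obtain ⟨ψ, hψ⟩ := Join.exists_extension P b p q (r ≫ χ)
  have hψ' {m} (w : (nerve (Join n (StructuredArrow (c.obj (Fin.last n)) F))).obj m)
      (z : (miss c F : SSet).obj m) (h : w ⋙ ofJoin c F = z.1) : ψ.app m w = χ.app m z := by
    obtain ⟨z, i, hi⟩ := z
    obtain rfl := h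
    exact ConcreteCategory.congr_hom (NatTrans.congr_app hψ m) ⟨w, i, fun j h =>
      hi j ((ofJoin_obj_eq_inl c F _ _).2 h)⟩
  let R (m) (z : (nerve (Coll c F)).obj m) (k : K.obj m) : Prop :=
    (∃ z' : (miss c F : SSet).obj m, z'.1 = z ∧ k = χ.app m z') ∨
      ∃ w : (nerve (Join n (StructuredArrow (c.obj (Fin.last n)) F))).obj m,
        w ⋙ ofJoin c F = z ∧ k = ψ.app m w
  have hR : ∃ ψ' : nerve (Coll c F) ⟶ K, ∀ m x, R m x (ψ'.app m x) :=
    exists_hom_of_rel R ?_ ?_ ?_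
  · obtain ⟨ψ', h⟩ := hR
    refine ⟨ψ', ?_⟩
    ext m z
    obtain ⟨z', hz', hz⟩ | ⟨w, hw, hz⟩ := h m z.1
    · obtain rfl := Subtype.ext hz'
      exact hz
    · exact hz.trans (hψ' w z hw)
  · intro m z
    by_cases hz : z ∈ (miss c F).obj m
    · exact ⟨_, Or.inl ⟨⟨z, hz⟩, rfl, rfl⟩⟩
    · obtain ⟨j, hj⟩ : ∃ j, vtx z j = inl (Fin.last n) := by
        by_contra! h
        exact hz ⟨_, h⟩
      obtain ⟨w, hw⟩ := exists_ofJoin z j hj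
      exact ⟨_, Or.inr ⟨w, hw, rfl⟩⟩
  · rintro m z k k' (⟨z, rfl, rfl⟩ | ⟨w, rfl, rfl⟩) (⟨z', hz', rfl⟩ | ⟨w', hw', rfl⟩)
    · rw [Subtype.ext hz']
    · exact (hψ' _ _ hw').symm
    · exact hψ' _ _ hz'.symm
    · by_cases hz : w ⋙ ofJoin c F ∈ (miss c F).obj m
      · rw [hψ' w ⟨_, hz⟩ rfl, hψ' w' ⟨_, hz⟩ hw']
      · obtain ⟨j, hj⟩ : ∃ j, vtx w j = inl (Fin.last n) := by
          by_contra! h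
          exact hz ⟨_, fun j hj => h j ((ofJoin_obj_eq_inl c F _ _).1 hj)⟩
        rw [ofJoin_unique w w' hw'.symm j hj]
  · rintro m m' f z k (⟨z, rfl, rfl⟩ | ⟨w, rfl, rfl⟩)
    · exact Or.inl ⟨_, rfl, (NatTrans.naturality_apply χ f z).symm⟩
    · exact Or.inr ⟨_, rfl, (NatTrans.naturality_apply ψ f w).symm⟩

end Coll

end Extension

section Family

namespace Coll

section Fill

variable {n : ℕ} {C : Type u₂} [Category.{v} C] {S : Type u} [Category.{v} S]
  {c : Fin (n + 1) ⥤ C} {F : S ⥤ C} {m : ℕ}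

/-- The index of an object of a collage. -/
def idx (X : Coll c F) : Fin (n + 1) := match X with
  | inl i => i
  | inr _ => 0

lemma idx_mono {X Y : Coll c F} (f : X ⟶ Y) (h : ∃ i, Y = inl i) : idx X ≤ idx Y := by
  obtain ⟨i, rfl⟩ := h
  cases X with
  | inl j => exact f.down.down
  | inr a => exact PEmpty.elim f

lemma exists_eq_inl_of_hom {X Y : Coll c F} (f : X ⟶ Y) (h : ∃ i, Y = inl i) :
    ∃ i, X = inl i := by
  obtain ⟨i, rfl⟩ := h
  cases X with
  | inl j => exact ⟨j, rfl⟩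
  | inr a => exact PEmpty.elim f

/-- The indices of the vertices of a simplex, extended constantly after the vertex `p`. -/
def fill (z : Fin (m + 1) ⥤ Coll c F) (p : Fin (m + 1)) (hp : ∀ j, (∃ i, z.obj j = inl i) ↔ j ≤ p) :
    Fin (m + 1) ⥤ Fin (n + 1) :=
  Monotone.functor (f := fun j => idx (z.obj (min j p))) (fun _ _ h =>
    idx_mono (z.map (homOfLE (min_le_min_right p h))) ((hp _).2 (min_le_right _ _)))

lemma fill_obj_of_eq_inl (z : Fin (m + 1) ⥤ Coll c F) (p : Fin (m + 1))
    (hp : ∀ j, (∃ i, z.obj j = inl i) ↔ j ≤ p) (j : Fin (m + 1)) (i : Fin (n + 1))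
    (hj : z.obj j = inl i) : (fill z p hp).obj j = i := by
  change idx (z.obj (min j p)) = i
  rw [min_eq_left ((hp j).1 ⟨i, hj⟩), hj]
  rfl

lemma fill_obj_ne (z : Fin (m + 1) ⥤ Coll c F) (p : Fin (m + 1))
    (hp : ∀ j, (∃ i, z.obj j = inl i) ↔ j ≤ p) (i : Fin (n + 1)) (hi : ∀ j, z.obj j ≠ inl i)
    (j : Fin (m + 1)) : (fill z p hp).obj j ≠ i := by
  obtain ⟨i', hi'⟩ := (hp (min j p)).2 (min_le_right _ _)
  change idx (z.obj (min j p)) ≠ i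
  rw [hi']
  rintro rfl
  exact hi _ hi'

lemma exists_last (z : Fin (m + 1) ⥤ Coll c F) (h : ∃ j i, z.obj j = inl i) :
    ∃ p, ∀ j, (∃ i, z.obj j = inl i) ↔ j ≤ p := by
  classical
  let A := Finset.univ.filter (fun j => ∃ i, z.obj j = inl i)
  have hA : A.Nonempty := by
    obtain ⟨j, hj⟩ := h
    exact ⟨j, by simpa [A] using hj⟩
  have hp : ∃ i, z.obj (A.max' hA) = inl i := by simpa [A] using A.max'_mem hA
  refine ⟨A.max' hA, fun j => ⟨fun hj => A.le_max' _ (by simpa [A] using hj), fun hj => ?_⟩⟩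
  exact exists_eq_inl_of_hom (z.map (homOfLE hj)) hp

lemma exists_inrF {J : Type*} [Category* J] (z : J ⥤ Coll c F) (h : ∀ j, ¬ ∃ i, z.obj j = inl i) :
    ∃ w : J ⥤ S, w ⋙ inrF c F = z := by
  have h' (j : J) : ∃ a, z.obj j = inr a := by
    have := h j
    generalize z.obj j = X at this
    cases X with
    | inl i => exact (this ⟨i, rfl⟩).elim
    | inr a => exact ⟨a, rfl⟩
  choose a ha using h'
  obtain ⟨zo, zm, hid, hcomp⟩ := z
  obtain rfl : zo = fun j => inr (a j) := funext ha
  exact ⟨{ obj := a, map := zm, map_id := hid, map_comp := hcomp }, rfl⟩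

lemma inrF_cancel {J : Type*} [Category* J] {w w' : J ⥤ S} (h : w ⋙ inrF c F = w' ⋙ inrF c F) :
    w = w' := by
  obtain ⟨a, f, _, _⟩ := w
  obtain ⟨a', f', _, _⟩ := w'
  obtain rfl : a = a' := funext fun j =>
    Coll.inr.inj (show (inr (a j) : Coll c F) = inr (a' j) from
      congrArg (fun z : J ⥤ _ => z.obj j) h)
  exact Functor.hext (fun _ => rfl) (fun _ _ g => eq_of_heq_map h g)

lemma exists_reindex_obj_eq_inl {k : ℕ} (θ : Fin (k + 1) ⥤ Fin (n + 1)) (X : Coll (θ ⋙ c) F) :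
    (∃ i, (reindex θ c F).obj X = inl i) ↔ ∃ i, X = inl i := by
  cases X with
  | inl i => exact ⟨fun _ => ⟨_, rfl⟩, fun _ => ⟨_, rfl⟩⟩
  | inr a => constructor <;> rintro ⟨i, hi⟩ <;> cases hi

end Fill

variable {n : ℕ} {C : Type u} [Category.{v} C] {S : Type u} [Category.{v} S]
  {c : Fin (n + 1) ⥤ C} {F : S ⥤ C}

/-- A compatible family of maps on the collages over the faces extends to the whole collage. -/
lemma exists_of_family (P : StructuredArrow (c.obj (Fin.last n)) F ⥤ _)
    (b : StructuredArrow (c.obj (Fin.last n)) F) (p : P ⟶ 𝟭 _) (q : P ⟶ (Functor.const _).obj b)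
    {K : SSet.{max u v}} [SSet.KanComplex K] (φ : nerve S ⟶ K)
    (Ψ : ∀ {m : ℕ} (θ : Fin (m + 1) ⥤ Fin (n + 1)), (∃ i, ∀ j, θ.obj j ≠ i) →
      (nerve (Coll (θ ⋙ c) F) ⟶ K))
    (hnat : ∀ {m k : ℕ} (s : Fin (k + 1) ⥤ Fin (m + 1)) (θ : Fin (m + 1) ⥤ Fin (n + 1)) hθ hsθ,
      nerveMap (reindex s (θ ⋙ c) F) ≫ Ψ θ hθ = Ψ (s ⋙ θ) hsθ)
    (hφ : ∀ {m : ℕ} (θ : Fin (m + 1) ⥤ Fin (n + 1)) hθ, nerveMap (inrF (θ ⋙ c) F) ≫ Ψ θ hθ = φ) :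
    ∃ ψ : nerve (Coll c F) ⟶ K, nerveMap (inrF c F) ≫ ψ = φ ∧
      ∀ {m : ℕ} (θ : Fin (m + 1) ⥤ Fin (n + 1)) hθ, nerveMap (reindex θ c F) ≫ ψ = Ψ θ hθ := by
  have hφ' {m : SimplexCategoryᵒᵖ} {d : ℕ} (θ : Fin (d + 1) ⥤ Fin (n + 1)) (hθ)
      (z' : (nerve (Coll (θ ⋙ c) F)).obj m) (w : (nerve S).obj m)
      (h : z' ⋙ reindex θ c F = w ⋙ inrF c F) : (Ψ θ hθ).app m z' = φ.app m w := by
    obtain ⟨w', rfl⟩ := exists_inrF z' (fun j hj => by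
      have := (exists_reindex_obj_eq_inl θ _).2 hj
      change ∃ i, Functor.obj (z' ⋙ reindex θ c F) j = _ at this
      rw [h] at this
      obtain ⟨i, hi⟩ := this
      cases hi)
    obtain rfl : w' = w := inrF_cancel (c := c) (F := F) h
    exact ConcreteCategory.congr_hom (NatTrans.congr_app (hφ θ hθ) m) w'
  have hfill {m : SimplexCategoryᵒᵖ} {d : ℕ} (θ : Fin (d + 1) ⥤ Fin (n + 1)) (hθ)
      (z' : (nerve (Coll (θ ⋙ c) F)).obj m) (z : (nerve (Coll c F)).obj m)
      (h : z' ⋙ reindex θ c F = z) (p) (hp) (h₁) :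
      (Ψ θ hθ).app m z' = (Ψ (fill (m := m.unop.len) z p hp) h₁).app m
        (lift z _ (fun j i hj => (fill_obj_of_eq_inl z p hp j i hj).le)) := by
    subst h
    have hp' (j) : (∃ i, Functor.obj z' j = inl i) ↔ j ≤ p :=
      (exists_reindex_obj_eq_inl θ _).symm.trans (hp j)
    let s := fill (m := m.unop.len) z' p hp'
    have hs : s ⋙ θ = fill (m := m.unop.len) (z' ⋙ reindex θ c F) p hp := by
      refine CategoryTheory.Functor.ext (fun j => ?_) (fun _ _ _ => Subsingleton.elim _ _)
      obtain ⟨i, hi⟩ := (hp' (min j p)).2 (min_le_right _ _)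
      change θ.obj (idx (Functor.obj z' (min j p))) =
        idx ((reindex θ c F).obj (Functor.obj z' (min j p)))
      rw [hi]
      rfl
    have h₂ : ∃ i, ∀ j, (s ⋙ θ).obj j ≠ i := hs ▸ h₁
    have h₃ (j i) (hj : Functor.obj z' j = inl i) : s.obj j = i :=
      fill_obj_of_eq_inl (m := m.unop.len) z' p hp' j i hj
    have h₄ : (Ψ θ hθ).app m z' = (Ψ (s ⋙ θ) h₂).app m (lift z' s fun j i hj => (h₃ j i hj).le) := by
      rw [← hnat s θ hθ h₂]
      exact congrArg _ (lift_reindex z' s h₃).symm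
    rw [h₄]
    generalize_proofs h₅ h₆
    rw [← lift_comp_reindex s θ z' h₅ (by rw [hs]; exact h₆)]
    have aux (z : (nerve (Coll c F)).obj m) (t t' : Fin (m.unop.len + 1) ⥤ Fin (n + 1)) (ht) (ht')
        (h : ∀ j i, Functor.obj z j = inl i → t.obj j ≤ i)
        (h' : ∀ j i, Functor.obj z j = inl i → t'.obj j ≤ i) (htt' : t = t') :
        (Ψ t ht).app m (lift z t h) = (Ψ t' ht').app m (lift z t' h') := by
      subst htt'
      rfl
    exact aux _ _ _ _ _ _ _ hs
  let R (m) (z : (miss c F : SSet).obj m) (k : K.obj m) : Prop :=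
    (∃ (d : ℕ) (θ : Fin (d + 1) ⥤ Fin (n + 1)) (hθ : _) (z' : (nerve (Coll (θ ⋙ c) F)).obj m),
      z' ⋙ reindex θ c F = z.1 ∧ k = (Ψ θ hθ).app m z') ∨
    ∃ w : (nerve S).obj m, w ⋙ inrF c F = z.1 ∧ k = φ.app m w
  have hRfun (m z k k') (h : R m z k) (h' : R m z k') : k = k' := by
    by_cases hz : ∃ w : (nerve S).obj m, w ⋙ inrF c F = z.1
    · obtain ⟨w, hw⟩ := hz
      have aux (k) (h : R m z k) : k = φ.app m w := by
        obtain ⟨d, θ, hθ, z', hz', rfl⟩ | ⟨w', hw', rfl⟩ := h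
        · exact hφ' θ hθ z' w (hz'.trans hw.symm)
        · rw [inrF_cancel (hw'.trans hw.symm)]
      rw [aux k h, aux k' h']
    · have hz' : ∃ j i, Functor.obj z.1 j = inl i := by
        by_contra! h
        exact hz (exists_inrF z.1 (fun j ⟨i, hi⟩ => h j i hi))
      obtain ⟨p, hp⟩ := exists_last (m := m.unop.len) z.1 hz'
      obtain ⟨i, hi⟩ := z.2
      have h₁ : ∃ i, ∀ j, (fill (m := m.unop.len) z.1 p hp).obj j ≠ i :=
        ⟨i, fill_obj_ne (m := m.unop.len) z.1 p hp i hi⟩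
      have aux (k) (h : R m z k) : k = (Ψ (fill (m := m.unop.len) z.1 p hp) h₁).app m
          (lift z.1 _ (fun j i hj => (fill_obj_of_eq_inl z.1 p hp j i hj).le)) := by
        obtain ⟨d, θ, hθ, z', hz', rfl⟩ | ⟨w', hw', rfl⟩ := h
        · exact hfill θ hθ z' z.1 hz' p hp h₁
        · exact (hz ⟨w', hw'⟩).elim
      rw [aux k h, aux k' h']
  have hR : ∃ χ : (miss c F : SSet) ⟶ K, ∀ m z, R m z (χ.app m z) := by
    refine exists_hom_of_rel R ?_ hRfun ?_
    · intro m z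
      by_cases hz' : ∃ j i, Functor.obj z.1 j = inl i
      · obtain ⟨p, hp⟩ := exists_last (m := m.unop.len) z.1 hz'
        obtain ⟨i, hi⟩ := z.2
        exact ⟨_, Or.inl ⟨_, fill (m := m.unop.len) z.1 p hp,
          ⟨i, fill_obj_ne (m := m.unop.len) z.1 p hp i hi⟩, _,
          lift_reindex z.1 _ (fill_obj_of_eq_inl z.1 p hp), rfl⟩⟩
      · obtain ⟨w, hw⟩ := exists_inrF z.1 (fun j ⟨i, hi⟩ => hz' ⟨j, i, hi⟩)
        exact ⟨_, Or.inr ⟨w, hw, rfl⟩⟩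
    · rintro m m' f z k (⟨d, θ, hθ, z', hz', rfl⟩ | ⟨w, hw, rfl⟩)
      · exact Or.inl ⟨d, θ, hθ, (nerve _).map f z', congrArg ((nerve _).map f) hz',
          (NatTrans.naturality_apply (Ψ θ hθ) f z').symm⟩
      · exact Or.inr ⟨(nerve _).map f w, congrArg ((nerve _).map f) hw,
          (NatTrans.naturality_apply φ f w).symm⟩
  obtain ⟨χ, hχ⟩ := hR
  obtain ⟨ψ, rfl⟩ := exists_extension P b p q χ
  refine ⟨ψ, ?_, fun θ hθ => ?_⟩
  · ext m w
    exact hRfun _ _ _ _ (hχ m ⟨w ⋙ inrF c F, 0, fun j h => by cases h⟩) (Or.inr ⟨w, rfl, rfl⟩)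
  · ext m z'
    refine hRfun _ _ _ _ (hχ m ⟨z' ⋙ reindex θ c F, hθ.imp fun i hi j h => ?_⟩)
      (Or.inl ⟨_, θ, hθ, z', rfl, rfl⟩)
    change (reindex θ c F).obj (vtx z' j) = inl i at h
    generalize vtx z' j = X at h
    cases X with
    | inl j' => cases h; exact hi _ rfl
    | inr a => cases h

end Coll

end Family

section TheoremA

open MonoidalCategory HomotopicalAlgebra SSet.modelCategoryQuillen

variable {C : Type u} [Category.{v} C] {S : Type u} [Category.{v} S] {F : S ⥤ C}

/-- The slices under all objects are contractible via a zigzag `𝟭 ⟵ P ⟶ b`. -/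
def SliceContractible (F : S ⥤ C) : Prop :=
  ∀ A : C, ∃ (P : StructuredArrow A F ⥤ StructuredArrow A F) (b : StructuredArrow A F),
    Nonempty (P ⟶ 𝟭 _) ∧ Nonempty (P ⟶ (Functor.const _).obj b)

variable {K : SSet.{max u v}}

/-- The functor underlying a morphism in the simplex category. -/
abbrev simplexMap {m m' : SimplexCategoryᵒᵖ} (f : m ⟶ m') :
    Fin (m'.unop.len + 1) ⥤ Fin (m.unop.len + 1) :=
  (SimplexCategory.toCat.map f.unop).toFunctor

/-- The simplices of the simplicial set of extensions of `φ` to collages. -/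
structure ExtObj (φ : nerve S ⟶ K) (F : S ⥤ C) (m : SimplexCategoryᵒᵖ) where
  base : Fin (m.unop.len + 1) ⥤ C
  hom : nerve (Coll base F) ⟶ K
  comm : nerveMap (Coll.inrF base F) ≫ hom = φ

lemma ExtObj.ext_of_eq {φ : nerve S ⟶ K} {m : SimplexCategoryᵒᵖ} {c : Fin (m.unop.len + 1) ⥤ C}
    {ψ ψ' : nerve (Coll c F) ⟶ K} {h} {h'} (e : ψ = ψ') :
    (⟨c, ψ, h⟩ : ExtObj φ F m) = ⟨c, ψ', h'⟩ := by
  subst e; rfl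

/-- The simplicial set of extensions of `φ` to collages. -/
def extSSet (φ : nerve S ⟶ K) (F : S ⥤ C) : SSet.{max u v} where
  obj m := ExtObj φ F m
  map f := ↾fun x => ⟨simplexMap f ⋙ x.base, nerveMap (Coll.reindex (simplexMap f) x.base F) ≫ x.hom,
    x.comm⟩
  map_id m := by
    ext x
    obtain ⟨c, ψ, h⟩ := x
    have : nerveMap (Coll.reindex (𝟭 _) c F) ≫ ψ = ψ := by rw [Coll.reindex_id]; rfl
    have key := ExtObj.ext_of_eq (φ := φ) (F := F) (h := by exact h) (h' := h) this
    exact key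
  map_comp {m m' m''} f g := by
    ext x
    obtain ⟨c, ψ, h⟩ := x
    have : nerveMap (Coll.reindex (simplexMap g ⋙ simplexMap f) c F) ≫ ψ =
        nerveMap (Coll.reindex (simplexMap g) (simplexMap f ⋙ c) F) ≫
          nerveMap (Coll.reindex (simplexMap f) c F) ≫ ψ := by rw [Coll.reindex_comp]; rfl
    have key := ExtObj.ext_of_eq (φ := φ) (F := F) (h := by exact h) (h' := by exact h) this
    exact key

/-- The projection to the nerve of the base. -/
def extBase (φ : nerve S ⟶ K) (F : S ⥤ C) : extSSet φ F ⟶ nerve C where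
  app m := ↾fun x => x.base

/-- The evaluation of an extension on the base. -/
def extEval (φ : nerve S ⟶ K) (F : S ⥤ C) : extSSet φ F ⟶ K where
  app m := ↾fun x => x.hom.app m (Coll.inlF x.base F)
  naturality m m' f := by
    ext x
    exact NatTrans.naturality_apply x.hom f (Coll.inlF x.base F)

lemma ExtObj.eq_of_mk_eq {φ : nerve S ⟶ K} {m : SimplexCategoryᵒᵖ} {c : Fin (m.unop.len + 1) ⥤ C}
    {ψ ψ' : nerve (Coll c F) ⟶ K} {h} {h'}
    (e : (⟨c, ψ, h⟩ : ExtObj φ F m) = ⟨c, ψ', h'⟩) : ψ = ψ' := by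
  cases e; rfl

/-- The functor underlying a simplex of `Δ[n]`. -/
abbrev simplexFun {n : ℕ} {m : SimplexCategoryᵒᵖ} (z : (Δ[n] : SSet.{w}).obj m) :
    Fin (m.unop.len + 1) ⥤ Fin (n + 1) :=
  (SSet.stdSimplex.asOrderHom z).monotone.functor

/-- The simplex of `Δ[n]` corresponding to a functor. -/
def simplexOfFun {n m : ℕ} (θ : Fin (m + 1) ⥤ Fin (n + 1)) :
    (Δ[n] : SSet.{w}).obj (Opposite.op (SimplexCategory.mk m)) :=
  SSet.stdSimplex.objEquiv.symm (SimplexCategory.Hom.mk ⟨θ.obj, θ.monotone⟩)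

lemma simplexOfFun_simplexFun {n m : ℕ}
    (z : (Δ[n] : SSet.{w}).obj (Opposite.op (SimplexCategory.mk m))) :
    simplexOfFun (simplexFun z) = z := by
  apply SSet.stdSimplex.objEquiv.injective
  ext j : 3
  rfl

lemma simplexOfFun_mem_boundary {n m : ℕ} (θ : Fin (m + 1) ⥤ Fin (n + 1))
    (hθ : ∃ i, ∀ j, θ.obj j ≠ i) : simplexOfFun.{w} θ ∈ (∂Δ[n] : SSet.Subcomplex _).obj _ := by
  rw [SSet.mem_boundary_iff_notMem_range]
  obtain ⟨i, hi⟩ := hθ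
  exact ⟨i, fun ⟨j, hj⟩ => hi j hj⟩

lemma rlp_extBase (hF : SliceContractible F) [SSet.KanComplex K] (φ : nerve S ⟶ K) :
    (SSet.modelCategoryQuillen.I : MorphismProperty SSet.{max u v}).rlp (extBase φ F) := by
  rintro _ _ _ ⟨n⟩
  refine ⟨fun {u v} sq => ?_⟩
  let c : Fin (n + 1) ⥤ C := SSet.yonedaEquiv v
  have hv {m : SimplexCategoryᵒᵖ} (z : (Δ[n] : SSet).obj m) : v.app m z = simplexFun z ⋙ c := by
    conv_lhs => rw [← SSet.yonedaEquiv.symm_apply_apply v]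
    rfl
  obtain ⟨P, b, ⟨p⟩, ⟨q⟩⟩ := hF (c.obj (Fin.last n))
  have hu {m : ℕ} (θ : Fin (m + 1) ⥤ Fin (n + 1)) (hθ : ∃ i, ∀ j, θ.obj j ≠ i) :
      ∃ (ψ : nerve (Coll (θ ⋙ c) F) ⟶ K) (h : nerveMap (Coll.inrF _ F) ≫ ψ = φ),
        u.app (Opposite.op (SimplexCategory.mk m)) ⟨simplexOfFun θ, simplexOfFun_mem_boundary θ hθ⟩
          = ExtObj.mk (m := Opposite.op (SimplexCategory.mk m)) (θ ⋙ c) ψ h := by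
    have hsq := ConcreteCategory.congr_hom (NatTrans.congr_app sq.w
      (Opposite.op (SimplexCategory.mk m))) ⟨simplexOfFun θ, simplexOfFun_mem_boundary θ hθ⟩
    generalize hx : u.app (Opposite.op (SimplexCategory.mk m))
      ⟨simplexOfFun θ, simplexOfFun_mem_boundary θ hθ⟩ = x
    have hb : x.base = θ ⋙ c := by
      rw [← hx]
      refine hsq.trans ?_
      exact (hv (simplexOfFun θ)).trans rfl
    obtain ⟨c', ψ, h⟩ := x
    obtain rfl : c' = θ ⋙ c := hb
    exact ⟨ψ, h, rfl⟩
  choose Ψ hΨ hu using @hu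
  obtain ⟨ψ, hψ, hψ'⟩ := Coll.exists_of_family P b p q φ Ψ (by
    intro m k s θ hθ hsθ
    refine ExtObj.eq_of_mk_eq (m := Opposite.op (SimplexCategory.mk k)) (φ := φ)
      (h := hΨ θ hθ) (h' := hΨ (s ⋙ θ) hsθ) ?_
    refine Eq.trans ?_ (hu (s ⋙ θ) hsθ)
    let f : SimplexCategory.mk k ⟶ SimplexCategory.mk m :=
      SimplexCategory.Hom.mk ⟨s.obj, s.monotone⟩
    have := NatTrans.naturality_apply u f.op
      ⟨simplexOfFun θ, simplexOfFun_mem_boundary θ hθ⟩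
    rw [hu θ hθ] at this
    exact this.symm) hΨ
  let e : (extSSet φ F).obj (Opposite.op (SimplexCategory.mk n)) := ⟨c, ψ, hψ⟩
  refine ⟨⟨⟨SSet.yonedaEquiv.symm e, ?_, ?_⟩⟩⟩
  · ext ⟨m⟩ ⟨z, hz⟩
    induction m using SimplexCategory.rec with | _ m
    have hθ : ∃ i, ∀ j, (simplexFun z).obj j ≠ i := by
      obtain ⟨i, hi⟩ := (SSet.mem_boundary_iff_notMem_range z).1 hz
      exact ⟨i, fun j hj => hi ⟨j, hj⟩⟩
    have hz' : (⟨simplexOfFun (simplexFun z), simplexOfFun_mem_boundary _ hθ⟩ :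
        (∂Δ[n] : SSet.Subcomplex _).obj (Opposite.op ⦋m⦌)) = ⟨z, hz⟩ :=
      Subtype.ext (simplexOfFun_simplexFun z)
    rw [← hz']
    exact (ExtObj.ext_of_eq (m := Opposite.op ⦋m⦌) (φ := φ) (h := hψ) (h' := hΨ _ hθ) (hψ' (simplexFun z) hθ)).trans
      (hu (simplexFun z) hθ).symm
  · rw [SSet.yonedaEquiv_symm_comp]
    exact SSet.yonedaEquiv.symm_apply_apply v

end TheoremA

section TheoremA

open MonoidalCategory HomotopicalAlgebra SSet.modelCategoryQuillen

variable {C : Type u} [Category.{v} C] {S : Type u} [Category.{v} S] {F : S ⥤ C}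

variable {K : SSet.{max u v}}

lemma hasLiftingProperty_extBase (hF : SliceContractible F) [SSet.KanComplex K] (φ : nerve S ⟶ K)
    {A B : SSet.{max u v}} (i : A ⟶ B) [Mono i] : HasLiftingProperty i (extBase φ F) := by
  have h := rlp_extBase hF φ
  rw [← SSet.rlp_monomorphisms] at h
  exact h i ‹_›

/-- `h` is the restriction to the base of an extension of `φ` to all collages of `F`. -/
def IsExt (F : S ⥤ C) (φ : nerve S ⟶ K) (h : nerve C ⟶ K) : Prop :=
  ∃ s : nerve C ⟶ extSSet φ F, s ≫ extBase φ F = 𝟙 _ ∧ s ≫ extEval φ F = h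

lemma exists_isExt (hF : SliceContractible F) [SSet.KanComplex K] (φ : nerve S ⟶ K) :
    ∃ h, IsExt F φ h := by
  let u : (⊥ : (nerve C).Subcomplex).toSSet ⟶ extSSet φ F :=
    { app m := ↾fun z => (z.2 : False).elim
      naturality m m' f := by ext z; exact (z.2 : False).elim }
  have := hasLiftingProperty_extBase hF φ (⊥ : (nerve C).Subcomplex).ι
  have sq : CommSq u (⊥ : (nerve C).Subcomplex).ι (extBase φ F) (𝟙 _) :=
    ⟨by ext m z; exact (z.2 : False).elim⟩
  exact ⟨sq.lift ≫ extEval φ F, sq.lift, sq.fac_right, rfl⟩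

/-- The two ends of a cylinder. -/
def cylEnds (X : SSet.{w}) : (X ⊗ Δ[1] : SSet.{w}).Subcomplex where
  obj _ := {z | ∀ j, (simplexFunctor z.2).obj j = (simplexFunctor z.2).obj 0}
  map _ _ hz _ := (hz _).trans (hz _).symm

lemma IsExt.sHomotopy (hF : SliceContractible F) [SSet.KanComplex K] {φ : nerve S ⟶ K}
    {h h' : nerve C ⟶ K} (H : IsExt F φ h) (H' : IsExt F φ h') : SHomotopy h h' := by
  classical
  obtain ⟨s, hs, rfl⟩ := H
  obtain ⟨s', hs', rfl⟩ := H'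
  let u : (cylEnds (nerve C)).toSSet ⟶ extSSet φ F :=
    { app m := ↾fun z => if (simplexFunctor z.1.2).obj 0 = 0 then s.app m z.1.1 else
        s'.app m z.1.1
      naturality m m' f := by
        ext ⟨z, hz⟩
        have h0 : (simplexFunctor ((nerve C ⊗ Δ[1] : SSet).map f z).2).obj 0 =
          (simplexFunctor z.2).obj 0 := hz _
        change (if (simplexFunctor ((nerve C ⊗ Δ[1] : SSet).map f z).2).obj 0 = 0 then
          s.app m' ((nerve C).map f z.1) else s'.app m' ((nerve C).map f z.1)) =
          (extSSet φ F).map f (if (simplexFunctor z.2).obj 0 = 0 then s.app m z.1 else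
            s'.app m z.1)
        rw [h0]
        split_ifs
        · exact NatTrans.naturality_apply s f z.1
        · exact NatTrans.naturality_apply s' f z.1 }
  have := hasLiftingProperty_extBase hF φ (cylEnds (nerve C)).ι
  have sq : CommSq u (cylEnds (nerve C)).ι (extBase φ F)
      (SemiCartesianMonoidalCategory.fst _ _) := by
    constructor
    ext m ⟨z, hz⟩
    change (extBase φ F).app m (if (simplexFunctor z.2).obj 0 = 0 then s.app m z.1 else
      s'.app m z.1) = z.1
    split_ifs
    · exact ConcreteCategory.congr_hom (NatTrans.congr_app hs m) z.1
    · exact ConcreteCategory.congr_hom (NatTrans.congr_app hs' m) z.1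
  rw [sHomotopy_iff]
  have he (ε : Fin 2) : SSet.Subcomplex.range (cylIncl (nerve C) ε) ≤ cylEnds (nerve C) := by
    rintro m _ ⟨x, rfl⟩ _
    rfl
  refine ⟨sq.lift ≫ extEval φ F, ?_, ?_⟩
  · rw [← Category.assoc]
    congr 1
    ext m x
    have hx : cylIncl (nerve C) 0 = SSet.Subcomplex.lift (B := cylEnds (nerve C)) (cylIncl _ 0) (he 0)
      ≫ (cylEnds (nerve C)).ι := rfl
    rw [hx, Category.assoc, sq.fac_left]
    exact if_pos (c := (simplexFunctor.{max u v} ((cylIncl (nerve C) 0).app m x).2).obj 0 = 0)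
      (e := s'.app m x) rfl
  · rw [← Category.assoc]
    congr 1
    ext m x
    have hx : cylIncl (nerve C) 1 = SSet.Subcomplex.lift (B := cylEnds (nerve C)) (cylIncl _ 1) (he 1)
      ≫ (cylEnds (nerve C)).ι := rfl
    rw [hx, Category.assoc, sq.fac_left]
    exact if_neg (t := s.app m x) (one_ne_zero (α := Fin 2))

lemma isExt_iff (φ : nerve S ⟶ K) (h : nerve C ⟶ K) :
    IsExt F φ h ↔ ∃ Ψ : ∀ {m : SimplexCategoryᵒᵖ} (c : Fin (m.unop.len + 1) ⥤ C),
      (nerve (Coll c F) ⟶ K), (∀ {m : SimplexCategoryᵒᵖ} (c : Fin (m.unop.len + 1) ⥤ C),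
        nerveMap (Coll.inrF c F) ≫ Ψ c = φ) ∧
      (∀ {m m' : SimplexCategoryᵒᵖ} (f : m ⟶ m') (c : Fin (m.unop.len + 1) ⥤ C),
        nerveMap (Coll.reindex (simplexMap f) c F) ≫ Ψ c = Ψ (simplexMap f ⋙ c)) ∧
      ∀ {m : SimplexCategoryᵒᵖ} (c : Fin (m.unop.len + 1) ⥤ C), h.app m c = (Ψ c).app m (Coll.inlF c F) := by
  constructor
  · rintro ⟨s, hs, rfl⟩
    have hs' {m : SimplexCategoryᵒᵖ} (c : Fin (m.unop.len + 1) ⥤ C) :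
        ∃ (ψ : nerve (Coll c F) ⟶ K) (h : nerveMap (Coll.inrF _ F) ≫ ψ = φ),
          s.app m c = ExtObj.mk (m := m) c ψ h := by
      have hsq := ConcreteCategory.congr_hom (NatTrans.congr_app hs m) c
      generalize hx : s.app m c = x
      have hb : x.base = c := by
        rw [← hx]
        exact hsq
      obtain ⟨c', ψ, h⟩ := x
      obtain rfl : c' = c := hb
      exact ⟨ψ, h, rfl⟩
    choose Ψ hΨ hsΨ using @hs'
    refine ⟨Ψ, hΨ, fun {m m'} f c => ?_, fun {m} c => ?_⟩
    · refine ExtObj.eq_of_mk_eq (m := m') (φ := φ) (h := hΨ c) (h' := hΨ (simplexMap f ⋙ c)) ?_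
      refine Eq.trans ?_ (hsΨ (simplexMap f ⋙ c))
      have := NatTrans.naturality_apply s f c
      rw [hsΨ c] at this
      exact this.symm
    · change (extEval φ F).app m (s.app m c) = _
      rw [hsΨ]
      rfl
  · rintro ⟨Ψ, h₁, h₂, h₃⟩
    refine ⟨{ app m := ↾fun c => (⟨c, Ψ c, h₁ c⟩ : ExtObj φ F m), naturality m m' f := ?_ }, rfl, ?_⟩
    · ext c
      exact ExtObj.ext_of_eq (m := m') (φ := φ) (h := h₁ (simplexMap f ⋙ c)) (h' := h₁ c)
        (h₂ f c).symm
    · ext m c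
      exact (h₃ c).symm

/-- The canonical transformation of a simplex of `S` inside the collage. -/
def inlToInr {n : ℕ} (x : Fin (n + 1) ⥤ S) (F : S ⥤ C) :
    Coll.inlF (x ⋙ F) F ⟶ x ⋙ Coll.inrF (x ⋙ F) F where
  app i := Coll.ofHom (c := x ⋙ F) (F := F) (𝟙 (F.obj (x.obj i)))
  naturality i j f := by
    have h : f = homOfLE (leOfHom f) := Subsingleton.elim _ _
    change (F.map (x.map (homOfLE (leOfHom f))) ≫ 𝟙 _ : F.obj (x.obj i) ⟶ F.obj (x.obj j)) =
      𝟙 _ ≫ F.map (x.map f)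
    rw [← h, Category.comp_id, Category.id_comp]

lemma mix_comp {J : Type*} [Category* J] {E : Type u} [Category.{v} E] {E' : Type u}
    [Category.{v} E'] (Φ : Fin 2 ⥤ (J ⥤ E)) (θ : J ⥤ Fin 2) (T : E ⥤ E') :
    mix Φ θ ⋙ T = mix (Φ ⋙ (Functor.whiskeringRight _ _ _).obj T) θ :=
  Functor.hext (fun _ => rfl) (fun _ _ _ => heq_of_eq (T.map_comp _ _))

lemma mix_inlToInr {n k : ℕ} (x : Fin (n + 1) ⥤ S) (F : S ⥤ C) (s : Fin (k + 1) ⥤ Fin (n + 1))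
    (θ : Fin (n + 1) ⥤ Fin 2) :
    mix (ComposableArrows.mk₁ (inlToInr (s ⋙ x) F)) (s ⋙ θ) ⋙ Coll.reindex s (x ⋙ F) F =
      s ⋙ mix (ComposableArrows.mk₁ (inlToInr x F)) θ := by
  have key : (ComposableArrows.mk₁ (inlToInr (s ⋙ x) F) : Fin 2 ⥤ _) ⋙
      (Functor.whiskeringRight _ _ _).obj (Coll.reindex s (x ⋙ F) F) =
      (ComposableArrows.mk₁ (inlToInr x F) : Fin 2 ⥤ _) ⋙
        (Functor.whiskeringLeft _ _ _).obj s := by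
    refine ComposableArrows.ext₁ rfl rfl ?_
    exact ((Category.id_comp _).trans (Category.comp_id _)).symm
  rw [mix_comp, key]
  rfl

lemma IsExt.restrict {φ : nerve S ⟶ K} {h : nerve C ⟶ K} (H : IsExt F φ h) :
    SHomotopy (nerveMap F ≫ h) φ := by
  obtain ⟨Ψ, h₁, h₂, h₃⟩ := (isExt_iff _ _).1 H
  rw [sHomotopy_iff]
  refine ⟨{ app m := ↾fun z => (Ψ (z.1 ⋙ F)).app m
              (mix (ComposableArrows.mk₁ (inlToInr z.1 F)) (simplexFunctor z.2))
            naturality m m' f := ?_ }, ?_, ?_⟩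
  · ext z
    refine Eq.trans ?_ (NatTrans.naturality_apply (Ψ (z.1 ⋙ F)) f _)
    refine Eq.trans (ConcreteCategory.congr_hom (NatTrans.congr_app (h₂ f (z.1 ⋙ F)).symm m') _) ?_
    exact congrArg ((Ψ (z.1 ⋙ F)).app m')
      (mix_inlToInr z.1 F (simplexMap f) (simplexFunctor z.2))
  · ext m x
    refine Eq.trans ?_ (h₃ (x ⋙ F)).symm
    exact congrArg ((Ψ (x ⋙ F)).app m) (mix_const _ _ 0 (fun _ => rfl))
  · ext m x
    refine Eq.trans ?_ (ConcreteCategory.congr_hom (NatTrans.congr_app (h₁ (x ⋙ F)) m) x)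
    exact congrArg ((Ψ (x ⋙ F)).app m) (mix_const _ _ 1 (fun _ => rfl))

lemma isExt_nerveMap_comp (F : S ⥤ C) (h : nerve C ⟶ K) : IsExt F (nerveMap F ≫ h) h := by
  rw [isExt_iff]
  refine ⟨fun c => nerveMap (Coll.toBase c F) ≫ h, fun c => rfl, fun f c => ?_, fun c => rfl⟩
  beta_reduce
  rw [← Coll.reindex_toBase]
  rfl

lemma IsExt.postcomp {φ : nerve S ⟶ K} {h : nerve C ⟶ K} (H : IsExt F φ h)
    {K' : SSet.{max u v}} (e : K ⟶ K') : IsExt F (φ ≫ e) (h ≫ e) := by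
  obtain ⟨Ψ, h₁, h₂, h₃⟩ := (isExt_iff _ _).1 H
  rw [isExt_iff]
  refine ⟨fun c => Ψ c ≫ e, fun c => ?_, fun f c => ?_, fun c => ?_⟩
  · rw [← h₁ c]; rfl
  · beta_reduce
    rw [← h₂ f c]; rfl
  · exact congrArg (e.app _) (h₃ c)

lemma Htpy.isExt (hF : SliceContractible F) {K : SSet.{max u v}} {φ φ' : nerve S ⟶ K}
    (H : Htpy φ φ') [SSet.KanComplex K] {h h' : nerve C ⟶ K} (hh : IsExt F φ h)
    (hh' : IsExt F φ' h') : Htpy h h' := by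
  induction H generalizing h h' with
  | rel φ φ' H =>
    rw [sHomotopy_iff] at H
    obtain ⟨H, rfl, rfl⟩ := H
    let K' := (ihom (Δ[1] : SSet.{max u v})).obj K
    let e (ε : Fin 2) : K' ⟶ K := CartesianMonoidalCategory.lift (constVertex K' ε) (𝟙 K') ≫
      (ihom.ev Δ[1]).app K
    let H' : nerve S ⟶ K' := MonoidalClosed.curry ((β_ _ _).hom ≫ H)
    have he (ε : Fin 2) : H' ≫ e ε = cylIncl _ ε ≫ H := by
      have h1 : H' ≫ e ε = CartesianMonoidalCategory.lift (constVertex _ ε) (𝟙 _) ≫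
        MonoidalClosed.uncurry H' := rfl
      rw [h1, MonoidalClosed.uncurry_curry]
      rfl
    have he' : SHomotopy (e 0) (e 1) := by
      rw [sHomotopy_iff]
      exact ⟨(β_ _ _).hom ≫ (ihom.ev Δ[1]).app K, rfl, rfl⟩
    obtain ⟨k, hk⟩ := exists_isExt hF H'
    have h0 := (hk.postcomp (e 0))
    have h1 := (hk.postcomp (e 1))
    rw [he] at h0 h1
    exact (hh.sHomotopy hF h0).htpy.trans ((he'.precomp k).htpy.trans (h1.sHomotopy hF hh').htpy)
  | refl φ => exact (hh.sHomotopy hF hh').htpy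
  | symm φ φ' _ ih => exact (ih hh' hh).symm
  | trans φ φ' φ'' _ _ ih₁ ih₂ =>
    obtain ⟨k, hk⟩ := exists_isExt hF φ'
    exact (ih₁ hh hk).trans (ih₂ hk hh')

/-- A form of Quillen's Theorem A. -/
theorem isWeakHomotopyEquiv_of_sliceContractible {C S : Type u} [Category.{v} C] [Category.{v} S]
    (F : S ⥤ C) (hF : SliceContractible F) : IsWeakHomotopyEquiv (nerveMap F) := by
  intro K hK
  have := kanComplex_mathlib K hK
  refine ⟨fun φ => ?_, fun h h' H => ?_⟩
  · obtain ⟨h, hh⟩ := exists_isExt hF φ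
    exact ⟨h, hh.restrict.htpy⟩
  · exact H.isExt hF (isExt_nerveMap_comp F h) (isExt_nerveMap_comp F h')

end TheoremA

section Chains

/-- The chains of composable morphisms in a category. -/
structure Chain (C : Type u) [Category.{v} C] where
  len : ℕ
  fn : Fin (len + 1) ⥤ C

namespace Chain

variable {C : Type u} [Category.{v} C]

/-- The functor underlying an order embedding. -/
abbrev embFunctor {m n : ℕ} (θ : Fin (m + 1) ↪o Fin (n + 1)) : Fin (m + 1) ⥤ Fin (n + 1) :=
  θ.monotone.functor

/-- The morphisms of chains: passing to a subchain. -/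
@[ext]
structure Hom (X Y : Chain C) : Type v where
  emb : Fin (Y.len + 1) ↪o Fin (X.len + 1)
  comm : embFunctor emb ⋙ X.fn = Y.fn

instance : Category.{v} (Chain C) where
  Hom := Hom
  id X := ⟨RelEmbedding.refl _, rfl⟩
  comp f g := ⟨g.emb.trans f.emb, by rw [← g.comm, ← f.comm]; rfl⟩

lemma hom_ext {X Y : Chain C} {f g : X ⟶ Y} (h : f.emb = g.emb) : f = g := Hom.ext h

/-- Restriction of a chain to a subchain. -/
abbrev res (X : Chain C) {n : ℕ} (θ : Fin (n + 1) ↪o Fin (X.len + 1)) : Chain C :=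
  ⟨n, embFunctor θ ⋙ X.fn⟩

/-- The projection to a subchain. -/
abbrev toRes (X : Chain C) {n : ℕ} (θ : Fin (n + 1) ↪o Fin (X.len + 1)) : X ⟶ X.res θ :=
  Hom.mk θ rfl

lemma hom_induction {X : Chain C} {motive : ∀ {Y : Chain C}, (X ⟶ Y) → Prop}
    (h : ∀ {n : ℕ} (θ : Fin (n + 1) ↪o Fin (X.len + 1)), motive (X.toRes θ))
    {Y : Chain C} (f : X ⟶ Y) : motive f := by
  obtain ⟨n, c⟩ := Y
  obtain ⟨θ, hc⟩ := f
  change Fin (n + 1) ↪o _ at θ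
  change embFunctor θ ⋙ _ = c at hc
  subst hc
  exact h θ

variable (C) in
/-- The functor sending a chain to its first object. -/
def head : Chain C ⥤ C where
  obj X := X.fn.obj 0
  map {X Y} f := X.fn.map (homOfLE (Fin.zero_le _)) ≫ eqToHom (Functor.congr_obj f.comm 0)
  map_id X := by
    change X.fn.map (𝟙 _) ≫ 𝟙 _ = _
    simp
  map_comp {X Y Z} f g := by
    induction f using hom_induction with | _ θ
    induction g using hom_induction with | _ τ
    change X.fn.map _ ≫ 𝟙 _ = (X.fn.map _ ≫ 𝟙 _) ≫ (X.fn.map _ ≫ 𝟙 _)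
    simp only [Category.comp_id]
    exact X.fn.map_comp (homOfLE _) ((embFunctor θ).map (homOfLE _))

lemma head_map_toRes (X : Chain C) {n : ℕ} (θ : Fin (n + 1) ↪o Fin (X.len + 1)) :
    (head C).map (X.toRes θ) = X.fn.map (homOfLE (Fin.zero_le (θ 0))) :=
  Category.comp_id _

/-- The functor on chains induced by a functor. -/
def mapChain {E : Type u} [Category.{v} E] (G : C ⥤ E) : Chain C ⥤ Chain E where
  obj X := ⟨X.len, X.fn ⋙ G⟩
  map f := Hom.mk f.emb (by rw [← f.comm]; rfl)

lemma mapChain_head {E : Type u} [Category.{v} E] (G : C ⥤ E) :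
    mapChain G ⋙ head E = head C ⋙ G := by
  refine CategoryTheory.Functor.ext (fun _ => rfl) ?_
  intro X Y f
  induction f using hom_induction with | _ θ
  change G.map _ ≫ 𝟙 _ = 𝟙 _ ≫ G.map (X.fn.map _ ≫ 𝟙 _) ≫ 𝟙 _
  simp
  rfl

lemma precomp_map_zero_succ {n : ℕ} (c : ComposableArrows C n) {A : C} (g : A ⟶ c.left)
    (j : Fin (n + 1)) : (c.precomp g).map (homOfLE (Fin.zero_le j.succ)) =
      g ≫ c.map (homOfLE (Fin.zero_le j)) := by
  obtain ⟨_ | j, hj⟩ := j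
  · exact (Category.comp_id g).symm.trans (congrArg (g ≫ ·) (c.map_id _).symm)
  · rfl

/-- Adding an object at the beginning of a chain. -/
abbrev cons {A : C} (X : Chain C) (g : A ⟶ X.fn.obj 0) : Chain C :=
  ⟨X.len + 1, ComposableArrows.precomp X.fn g⟩

/-- Extension of an order embedding by the first element. -/
def consEmb {m n : ℕ} (θ : Fin (m + 1) ↪o Fin (n + 1)) : Fin (m + 2) ↪o Fin (n + 2) :=
  OrderEmbedding.ofStrictMono (Fin.cases 0 (fun j => (θ j).succ)) (by
    intro i j h
    cases i using Fin.cases <;> cases j using Fin.cases <;> simp_all)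

lemma consEmb_comm {A : C} {X Y : Chain C} (f : X ⟶ Y) (g : A ⟶ X.fn.obj 0) :
    embFunctor (consEmb f.emb) ⋙ ComposableArrows.precomp X.fn g =
      ComposableArrows.precomp Y.fn (g ≫ (head C).map f) := by
  induction f using hom_induction with | _ θ
  refine ComposableArrows.ext_succ rfl rfl ?_
  refine Eq.trans ?_ ((Category.id_comp _).trans (Category.comp_id _)).symm
  exact (precomp_map_zero_succ _ g (θ 0)).trans (congrArg (g ≫ ·) (head_map_toRes X θ).symm)

/-- The inclusion of the vertices of a chain in the chain with one more object. -/
def consHom {A : C} (X : Chain C) (g : A ⟶ X.fn.obj 0) : X.cons g ⟶ X :=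
  Hom.mk (Fin.succOrderEmb _) rfl

/-- The functor adding an object at the beginning of a chain. -/
def consFunctor (A : C) : StructuredArrow A (head C) ⥤ StructuredArrow A (head C) where
  obj s := StructuredArrow.mk (Y := Chain.cons s.right s.hom) (𝟙 A)
  map {s t} f := StructuredArrow.homMk
    (Hom.mk (consEmb f.right.emb) ((consEmb_comm f.right s.hom).trans
      (congrArg (fun g => ComposableArrows.precomp t.right.fn g) (StructuredArrow.w f)))) (by
        exact (Category.id_comp _).trans ((Category.comp_id _).trans
          ((ComposableArrows.precomp s.right.fn s.hom).map_id 0)))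
  map_id s := by
    apply StructuredArrow.hom_ext
    apply hom_ext
    ext j
    induction j using Fin.cases <;> rfl
  map_comp f g := by
    apply StructuredArrow.hom_ext
    apply hom_ext
    ext j
    induction j using Fin.cases <;> rfl

lemma sliceContractible_head (C : Type (max u v)) [Category.{v} C] : SliceContractible (head C) := by
  intro A
  let b : StructuredArrow A (head C) :=
    StructuredArrow.mk (Y := Chain.mk 0 (ComposableArrows.mk₀ A)) (𝟙 A)
  refine ⟨consFunctor A, b, ⟨?_⟩, ⟨?_⟩⟩
  · exact {
      app s := StructuredArrow.homMk (consHom s.right s.hom) (by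
        refine (Category.id_comp _).trans ((Category.comp_id _).trans ?_)
        exact (precomp_map_zero_succ _ s.hom 0).trans
          ((congrArg (s.hom ≫ ·) (s.right.fn.map_id 0)).trans (Category.comp_id _)))
      naturality s t f := by
        apply StructuredArrow.hom_ext
        apply hom_ext
        ext j
        rfl }
  · exact {
      app s := StructuredArrow.homMk (Hom.mk (OrderEmbedding.ofStrictMono
          (fun _ => 0 : Fin 1 → Fin (s.right.len + 2)) (Subsingleton.strictMono (α := Fin 1) _))
            (ComposableArrows.ext₀ rfl)) (by
        refine (Category.id_comp _).trans ((Category.comp_id _).trans ?_)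
        exact (ComposableArrows.precomp s.right.fn s.hom).map_id 0)
      naturality s t f := by
        apply StructuredArrow.hom_ext
        apply hom_ext
        ext j
        rfl }

lemma finite_hom (X : Chain C) (n : ℕ) : Finite {p : Σ Y, X ⟶ Y // p.1.len = n} := by
  refine Finite.of_injective (β := Fin (n + 1) → Fin (X.len + 1))
    (fun p j => p.1.2.emb (Fin.cast (by rw [p.2]) j)) ?_
  rintro ⟨⟨⟨m, c⟩, ⟨θ, hθ⟩⟩, hm⟩ ⟨⟨⟨m', c'⟩, ⟨τ, hτ⟩⟩, hm'⟩ h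
  change m = n at hm
  change m' = n at hm'
  subst hm hm'
  change Fin (m' + 1) ↪o _ at θ τ
  change embFunctor θ ⋙ _ = c at hθ
  change embFunctor τ ⋙ _ = c' at hτ
  obtain rfl : θ = τ := by
    ext j
    exact congrArg Fin.val (congrFun h j)
  subst hθ hτ
  rfl

lemma len_le {X Y : Chain C} (f : X ⟶ Y) : Y.len ≤ X.len := by
  have := Fintype.card_le_of_embedding f.emb.toEmbedding
  simpa using this

lemma eq_of_len_eq {X Y : Chain C} (f : X ⟶ Y) (h : Y.len = X.len) :
    ∃ e : X = Y, f = eqToHom e := by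
  induction f using hom_induction with | _ θ
  dsimp only at h
  subst h
  obtain rfl : θ = RelEmbedding.refl _ := by
    have h := Subsingleton.elim
      (RelIso.ofSurjective θ (Finite.surjective_of_injective θ.injective)) (OrderIso.refl _)
    ext j
    exact congrArg Fin.val (congrArg (fun e : Fin (X.len + 1) ≃o Fin (X.len + 1) => e j) h)
  exact ⟨rfl, rfl⟩

end Chain

end Chains

section Reedy

variable {I : Type*} [Category* I] (deg : I → ℕ) (n : ℕ)

/-- The arrows from `i` to an object of degree `n`. -/
abbrev DegIndex (i : I) : Type _ := {p : Σ j, i ⟶ j // deg p.1 = n}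

variable [HasFiniteProducts D] [∀ i : I, Finite (DegIndex deg n i)]

/-- The value at `i` of the functor cofreely generated by a family of objects in degree `n`. -/
noncomputable def cofreeObj (E : I → D) (i : I) : D := ∏ᶜ fun p : DegIndex deg n i => E p.1.1

variable {deg n}

/-- The projection indexed by an arrow to an object of degree `n`. -/
noncomputable def cofreeπ (E : I → D) {i j : I} (u : i ⟶ j) (hj : deg j = n) :
    cofreeObj deg n E i ⟶ E j :=
  Pi.π (fun p : DegIndex deg n i => E p.1.1) ⟨⟨j, u⟩, hj⟩

/-- The map to `cofreeObj deg n E i` with given components. -/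
noncomputable def cofreeLift {E : I → D} {i : I} {A : D}
    (k : ∀ j, (i ⟶ j) → deg j = n → (A ⟶ E j)) : A ⟶ cofreeObj deg n E i :=
  Pi.lift fun p : DegIndex deg n i => k p.1.1 p.1.2 p.2

lemma cofreeLift_π {E : I → D} {i : I} {A : D}
    (k : ∀ j, (i ⟶ j) → deg j = n → (A ⟶ E j)) {j : I} (u : i ⟶ j) (hj : deg j = n) :
    cofreeLift k ≫ cofreeπ E u hj = k j u hj :=
  Pi.lift_π _ _

lemma cofreeObj_hom_ext {E : I → D} {i : I} {A : D} {f g : A ⟶ cofreeObj deg n E i}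
    (h : ∀ j (u : i ⟶ j) (hj : deg j = n), f ≫ cofreeπ E u hj = g ≫ cofreeπ E u hj) : f = g :=
  Pi.hom_ext _ _ fun p => h p.1.1 p.1.2 p.2

variable (deg n) in
/-- The functor cofreely generated by a family of objects in degree `n`. -/
noncomputable def cofree (E : I → D) : I ⥤ D where
  obj i := cofreeObj deg n E i
  map w := cofreeLift fun _ u hj => cofreeπ E (w ≫ u) hj
  map_id i := cofreeObj_hom_ext fun j u hj => by simp [cofreeLift_π]
  map_comp v w := cofreeObj_hom_ext fun j u hj => by simp [cofreeLift_π]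

namespace cofree

/-- The projection of `cofree` indexed by an arrow to an object of degree `n`. -/
noncomputable def π (E : I → D) {i j : I} (u : i ⟶ j) (hj : deg j = n) :
    (cofree deg n E).obj i ⟶ E j :=
  cofreeπ E u hj

lemma map_π (E : I → D) {i' i j : I} (w : i' ⟶ i) (u : i ⟶ j) (hj : deg j = n) :
    (cofree deg n E).map w ≫ π E u hj = π E (w ≫ u) hj :=
  cofreeLift_π (fun _ u hj => cofreeπ E (w ≫ u) hj) u hj

lemma hom_ext {E : I → D} {i : I} {A : D} {f g : A ⟶ (cofree deg n E).obj i}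
    (h : ∀ j (u : i ⟶ j) (hj : deg j = n), f ≫ π E u hj = g ≫ π E u hj) : f = g :=
  cofreeObj_hom_ext h

lemma isIso_π (E : I → D) {i : I} (hi : deg i = n)
    (h : ∀ p : DegIndex deg n i, p = ⟨⟨i, 𝟙 i⟩, hi⟩) : IsIso (π E (𝟙 i) hi) :=
  let _ : Unique (DegIndex deg n i) := ⟨⟨⟨⟨i, 𝟙 i⟩, hi⟩⟩, h⟩
  (productUniqueIso (fun p : DegIndex deg n i => E p.1.1)).isIso_hom

/-- The components of `cofree.map`. -/
noncomputable def mapApp {E E' : I → D} (r : ∀ i, E i ⟶ E' i) (i : I) :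
    (cofree deg n E).obj i ⟶ (cofree deg n E').obj i :=
  Limits.Pi.map fun p : DegIndex deg n i => r p.1.1

lemma mapApp_π {E E' : I → D} (r : ∀ i, E i ⟶ E' i) {i j : I} (u : i ⟶ j) (hj : deg j = n) :
    mapApp r i ≫ π E' u hj = π E u hj ≫ r j :=
  Limits.Pi.map_π _ (⟨⟨j, u⟩, hj⟩ : DegIndex deg n i)

variable (deg n) in
/-- The map of cofree functors induced by a family of maps. -/
noncomputable def map {E E' : I → D} (r : ∀ i, E i ⟶ E' i) :
    cofree deg n E ⟶ cofree deg n E' where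
  app := mapApp r
  naturality i i' w := hom_ext fun j u hj => by
    rw [Category.assoc, Category.assoc, mapApp_π, map_π, mapApp_π, ← Category.assoc, map_π]

/-- The components of `cofree.lift`. -/
noncomputable def liftApp {X : I ⥤ D} {E : I → D} (e : ∀ i, X.obj i ⟶ E i) (i : I) :
    X.obj i ⟶ (cofree deg n E).obj i :=
  cofreeLift fun j u _ => X.map u ≫ e j

lemma liftApp_π {X : I ⥤ D} {E : I → D} (e : ∀ i, X.obj i ⟶ E i) {i j : I} (u : i ⟶ j)
    (hj : deg j = n) : liftApp e i ≫ π E u hj = X.map u ≫ e j :=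
  cofreeLift_π (fun j u _ => X.map u ≫ e j) u hj

variable (deg n) in
/-- The map to the cofree functor adjoint to a family of maps. -/
noncomputable def lift {X : I ⥤ D} {E : I → D} (e : ∀ i, X.obj i ⟶ E i) :
    X ⟶ cofree deg n E where
  app := liftApp e
  naturality i i' w := hom_ext fun j u hj => by
    rw [Category.assoc, Category.assoc, liftApp_π, map_π, liftApp_π, X.map_comp, Category.assoc]

end cofree

end Reedy

section Diagonal

variable {I : Type*} [Category* I] (T : ℕᵒᵖ ⥤ I ⥤ D) (d : I ⥤ ℕᵒᵖ)

/-- The diagonal functor attached to a tower of functors and a degree function. -/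
def diagonal : I ⥤ D where
  obj i := (T.obj (d.obj i)).obj i
  map w := (T.map (d.map w)).app _ ≫ (T.obj _).map w

/-- The map to the diagonal induced by compatible maps to a tower. -/
def toDiagonal {X : I ⥤ D} (α : ∀ n, X ⟶ T.obj n)
    (hα : ∀ {m n} (f : m ⟶ n), α m ≫ T.map f = α n) : X ⟶ diagonal T d where
  app i := (α (d.obj i)).app i
  naturality i j w := by
    have h : (α (d.obj i)).app i ≫ (T.map (d.map w)).app i = (α (d.obj j)).app i :=
      NatTrans.congr_app (hα (d.map w)) i
    change _ = (α (d.obj i)).app i ≫ (T.map (d.map w)).app i ≫ (T.obj (d.obj j)).map w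
    rw [← Category.assoc, h]
    exact (α (d.obj j)).naturality w

/-- The map from the diagonal induced by compatible maps from a tower. -/
def fromDiagonal {Y : I ⥤ D} (β : ∀ n, T.obj n ⟶ Y)
    (hβ : ∀ {m n} (f : m ⟶ n), T.map f ≫ β n = β m) : diagonal T d ⟶ Y where
  app i := (β (d.obj i)).app i
  naturality i j w := by
    have h : (T.map (d.map w)).app i ≫ (β (d.obj j)).app i = (β (d.obj i)).app i :=
      NatTrans.congr_app (hβ (d.map w)) i
    change ((T.map (d.map w)).app i ≫ (T.obj (d.obj j)).map w) ≫ (β (d.obj j)).app j = _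
    rw [Category.assoc, (β (d.obj j)).naturality, ← Category.assoc, h]
    rfl

end Diagonal

section Tower

variable {I : Type*} [Category* I] {deg : I → ℕ}
  (hfin : ∀ i n, Finite (DegIndex deg n i))
  (hid : ∀ {i j : I} (u : i ⟶ j), deg j = deg i → ∃ e : i = j, u = eqToHom e)
  (L R : MorphismProperty D) [MorphismProperty.IsWeakFactorizationSystem L R]
  [HasFiniteLimits D]

include hfin hid in
lemma exists_factorization_in_degree {X Z : I ⥤ D} (t : X ⟶ Z) (n : ℕ) :
    ∃ (Z' : I ⥤ D) (t' : X ⟶ Z') (q : Z' ⟶ Z), t' ≫ q = t ∧ (∀ i, R (q.app i)) ∧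
      ∀ i, deg i = n → L (t'.app i) := by
  have hL : L = R.llp := (MorphismProperty.llp_eq_of_wfs L R).symm
  have hR : R = L.rlp := (MorphismProperty.rlp_eq_of_wfs L R).symm
  have hfac (j : I) : ∃ (E : D) (e : X.obj j ⟶ E) (r : E ⟶ Z.obj j),
      e ≫ r = t.app j ∧ L e ∧ R r :=
    let d := MorphismProperty.factorizationData L R (t.app j)
    ⟨d.Z, d.i, d.p, d.fac, d.hi, d.hp⟩
  choose E e r fac he hr using hfac
  have := fun i => hfin i n
  let f : Z ⟶ cofree deg n Z.obj := cofree.lift deg n fun i => 𝟙 (Z.obj i)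
  let g : cofree deg n E ⟶ cofree deg n Z.obj := cofree.map deg n r
  have w : t ≫ f = cofree.lift deg n e ≫ g := by
    ext i
    refine cofree.hom_ext fun j u hj => ?_
    change (t.app i ≫ cofree.liftApp (fun i => 𝟙 (Z.obj i)) i) ≫ cofree.π Z.obj u hj =
      (cofree.liftApp e i ≫ cofree.mapApp r i) ≫ cofree.π Z.obj u hj
    rw [Category.assoc, Category.assoc, cofree.liftApp_π,
      cofree.mapApp_π, ← Category.assoc (cofree.liftApp e i), cofree.liftApp_π, Category.assoc, fac]
    simp
  have hpb (i : I) := (IsPullback.of_hasPullback f g).map ((evaluation I D).obj i)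
  refine ⟨pullback f g, pullback.lift t (cofree.lift deg n e) w, pullback.fst f g,
    pullback.lift_fst _ _ _, fun i => ?_, fun i hi => ?_⟩
  · have hg : R (g.app i) := by
      rw [hR]
      intro A B k hk
      have (p : DegIndex deg n i) : HasLiftingProperty k (r p.1.1) := by
        have := hr p.1.1
        rw [hR] at this
        exact this k hk
      exact inferInstanceAs (HasLiftingProperty k
        (Limits.Pi.map fun p : DegIndex deg n i => r p.1.1))
    have : R.IsStableUnderBaseChange := by rw [hR]; infer_instance
    exact MorphismProperty.of_isPullback (hpb i).flip hg
  · have : L.RespectsIso := by rw [hL]; infer_instance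
    have hπ (E : I → D) : IsIso (cofree.π E (𝟙 i) hi) := cofree.isIso_π E hi <| by
      rintro ⟨⟨j, u⟩, hj⟩
      change deg j = n at hj
      obtain ⟨e, rfl⟩ := hid u (hj.trans hi.symm)
      subst e
      rfl
    have hf : IsIso (f.app i) := by
      have hπ' := hπ Z.obj
      have h : f.app i ≫ cofree.π Z.obj (𝟙 i) hi = 𝟙 _ :=
        (cofree.liftApp_π (fun i => 𝟙 (Z.obj i)) (𝟙 i) hi).trans (by simp)
      have : IsIso (𝟙 (Z.obj i)) := inferInstance
      rw [← h] at this
      exact IsIso.of_isIso_comp_right _ (cofree.π Z.obj (𝟙 i) hi)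
    have hs : IsIso ((pullback.snd f g).app i) := (hpb i).isIso_snd_of_isIso hf
    have := hπ E
    have key : (pullback.lift t (cofree.lift deg n e) w).app i ≫ (pullback.snd f g).app i ≫
        cofree.π E (𝟙 i) hi = e i := by
      rw [← Category.assoc, ← NatTrans.comp_app, pullback.lift_snd]
      exact (cofree.liftApp_π _ _ _).trans (by simp)
    have hLe := he i
    rw [← key] at hLe
    exact (MorphismProperty.cancel_right_of_respectsIso L _ _).1 hLe

include hfin hid in
lemma exists_reedy_factorization (hle : ∀ {i j : I}, (i ⟶ j) → deg j ≤ deg i)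
    {X Y : I ⥤ D} (t : X ⟶ Y) :
    ∃ (Z : I ⥤ D) (a : X ⟶ Z) (p : Z ⟶ Y), a ≫ p = t ∧ (∀ i, L (a.app i)) ∧
      ∀ i, R (p.app i) := by
  have hR : R = L.rlp := (MorphismProperty.rlp_eq_of_wfs L R).symm
  have : R.IsMultiplicative := by rw [hR]; infer_instance
  have step (s : Σ Z : I ⥤ D, (X ⟶ Z)) (n : ℕ) :=
    exists_factorization_in_degree hfin hid L R s.2 n
  choose Z' t' q' fac hq ht using step
  let S (n : ℕ) : Σ Z : I ⥤ D, (X ⟶ Z) :=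
    Nat.rec ⟨Y, t⟩ (fun n s => ⟨Z' s n, t' s n⟩) n
  let q (n : ℕ) : (S (n + 1)).1 ⟶ (S n).1 := q' (S n) n
  let T : ℕᵒᵖ ⥤ I ⥤ D := Functor.ofOpSequence (X := fun n => (S n).1) q
  have hT (n : ℕ) : T.map (homOfLE (n.le_add_right 1)).op = q n :=
    Functor.ofOpSequence_map_homOfLE_succ (X := fun n => (S n).1) q n
  let α : (Functor.const ℕᵒᵖ).obj X ⟶ T := NatTrans.ofOpSequence (fun n => (S n).2) fun n => by
    rw [hT]
    exact (Category.id_comp _).trans (fac (S n) n).symm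
  have hTR (n : ℕ) (i : I) : R ((T.map (homOfLE n.zero_le).op).app i) := by
    induction n with
    | zero =>
      have : (homOfLE (Nat.zero_le 0)).op = 𝟙 _ := rfl
      rw [this, T.map_id]
      exact R.id_mem _
    | succ n ih =>
      have : (homOfLE (Nat.zero_le (n + 1))).op =
          (homOfLE (n.le_add_right 1)).op ≫ (homOfLE n.zero_le).op := rfl
      rw [this, T.map_comp, hT]
      exact R.comp_mem _ _ (hq (S n) n i) ih
  let d : I ⥤ ℕᵒᵖ :=
    { obj := fun i => .op (deg i + 1)
      map := fun w => (homOfLE (Nat.succ_le_succ (hle w))).op }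
  have hα {m n : ℕᵒᵖ} (f : m ⟶ n) : α.app m ≫ T.map f = α.app n :=
    (α.naturality f).symm.trans (Category.id_comp _)
  have hβ {m n : ℕᵒᵖ} (f : m ⟶ n) : T.map f ≫ T.map (homOfLE n.unop.zero_le).op =
      T.map (homOfLE m.unop.zero_le).op := (T.map_comp _ _).symm
  refine ⟨diagonal T d, toDiagonal T d α.app hα,
    fromDiagonal T d (fun n => T.map (homOfLE n.unop.zero_le).op) hβ,
    ?_, fun i => ht (S (deg i)) (deg i) i rfl, fun i => hTR (deg i + 1) i⟩
  ext i
  exact NatTrans.congr_app (hα (homOfLE (deg i + 1).zero_le).op) i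

end Tower

namespace ModelStructure

variable (M : ModelStructure D)

lemma isStableUnderRetracts_of {P : MorphismProperty D}
    (h : ∀ {X Y X' Y' : D} {f : X ⟶ Y} {g : X' ⟶ Y'}, IsRetractOf f g → P g → P f) :
    P.IsStableUnderRetracts :=
  ⟨fun r hg => h ⟨r.i.left, r.r.left, r.i.right, r.r.right, r.retract_left, r.retract_right,
    r.i_w, r.r_w⟩ hg⟩

lemma isWeakFactorizationSystem_acof_fib :
    MorphismProperty.IsWeakFactorizationSystem (M.Cof ⊓ M.W) M.Fib := by
  have := isStableUnderRetracts_of M.Fib_retract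
  have : (M.Cof ⊓ M.W).IsStableUnderRetracts := isStableUnderRetracts_of fun hr h =>
    ⟨M.Cof_retract hr h.1, M.W_retract hr h.2⟩
  have : MorphismProperty.HasFactorization (M.Cof ⊓ M.W) M.Fib := ⟨fun f => by
    obtain ⟨Z, i, p, hi, hi', hp, h⟩ := M.fact_acof_fib f
    exact ⟨⟨Z, i, p, h, ⟨hi, hi'⟩, hp⟩⟩⟩
  exact .mk' _ _ fun i p hi hp => M.lifting_acof_fib i p hi.1 hi.2 hp

lemma isWeakFactorizationSystem_cof_afib :
    MorphismProperty.IsWeakFactorizationSystem M.Cof (M.Fib ⊓ M.W) := by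
  have := isStableUnderRetracts_of M.Cof_retract
  have : (M.Fib ⊓ M.W).IsStableUnderRetracts := isStableUnderRetracts_of fun hr h =>
    ⟨M.Fib_retract hr h.1, M.W_retract hr h.2⟩
  have : MorphismProperty.HasFactorization M.Cof (M.Fib ⊓ M.W) := ⟨fun f => by
    obtain ⟨Z, i, p, hi, hp, hp', h⟩ := M.fact_cof_afib f
    exact ⟨⟨Z, i, p, h, hi, ⟨hp, hp'⟩⟩⟩⟩
  exact .mk' _ _ fun i p hi hp => M.lifting_cof_afib i p hi hp.1 hp.2

lemma Fib_of_isPullback {A B A' B' : D} {t : A' ⟶ A} {l : A' ⟶ B'} {r : A ⟶ B} {b : B' ⟶ B}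
    (h : IsPullback t l r b) (hr : M.Fib r ∧ M.W r) : M.Fib l ∧ M.W l := by
  have := M.isWeakFactorizationSystem_cof_afib
  have : (M.Fib ⊓ M.W).IsStableUnderBaseChange := by
    rw [← MorphismProperty.rlp_eq_of_wfs M.Cof (M.Fib ⊓ M.W)]; infer_instance
  exact MorphismProperty.of_isPullback (P := M.Fib ⊓ M.W) h hr

lemma Cof_of_isPushout {A B A' B' : D} {t : A ⟶ A'} {l : A ⟶ B} {r : A' ⟶ B'} {b : B ⟶ B'}
    (h : IsPushout t l r b) (hl : M.Cof l ∧ M.W l) : M.Cof r ∧ M.W r := by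
  have := M.isWeakFactorizationSystem_acof_fib
  have : (M.Cof ⊓ M.W).IsStableUnderCobaseChange := by
    rw [← MorphismProperty.llp_eq_of_wfs (M.Cof ⊓ M.W) M.Fib]; infer_instance
  exact MorphismProperty.of_isPushout (P := M.Cof ⊓ M.W) h hl

end ModelStructure

section FullSubcategoryNerve

variable {C : Type (max u v)} [Category.{v} C] (P : ObjectProperty C)

/-- The natural transformation between lifts to a full subcategory. -/
def liftNatTrans {J : Type*} [Category* J] {P : ObjectProperty C} {F G : J ⥤ P.FullSubcategory}
    (τ : F ⋙ P.ι ⟶ G ⋙ P.ι) : F ⟶ G where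
  app j := ObjectProperty.homMk (τ.app j)
  naturality _ _ f := ObjectProperty.hom_ext _ (τ.naturality f)

open Chain in
lemma isWeakHomotopyEquiv_nerveMap_ι {G₁ G₂ : Chain C ⥤ C} (τ : head C ⟶ G₁) (τ' : G₂ ⟶ G₁)
    (h₂ : ∀ s, P (G₂.obj s)) (h₁ : ∀ s, P ((head C).obj s) → P (G₁.obj s)) :
    IsWeakHomotopyEquiv (nerveMap P.ι) := by
  let F : Chain C ⥤ P.FullSubcategory := P.lift G₂ h₂
  let j : Chain P.FullSubcategory ⥤ Chain C := mapChain P.ι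
  have hC := isWeakHomotopyEquiv_of_sliceContractible (head C) (sliceContractible_head C)
  have hP := isWeakHomotopyEquiv_of_sliceContractible (head P.FullSubcategory)
    (sliceContractible_head P.FullSubcategory)
  have hj : nerveMap j ≫ nerveMap (head C) = nerveMap (head P.FullSubcategory) ≫ nerveMap P.ι :=
    congrArg nerveMap (mapChain_head P.ι)
  have hF : Htpy (nerveMap F ≫ nerveMap P.ι) (nerveMap (head C)) :=
    (htpy_of_natTrans τ').trans (htpy_of_natTrans τ).symm
  let G : Chain P.FullSubcategory ⥤ P.FullSubcategory := P.lift (j ⋙ G₁) fun s => by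
    refine h₁ _ ?_
    rw [← Functor.comp_obj, mapChain_head]
    exact ((head P.FullSubcategory).obj s).property
  have hjF : Htpy (nerveMap j ≫ nerveMap F) (nerveMap (head P.FullSubcategory)) := by
    have t₁ : j ⋙ F ⟶ G := liftNatTrans (Functor.whiskerLeft j τ')
    have t₂ : head P.FullSubcategory ⟶ G :=
      liftNatTrans (eqToHom (mapChain_head P.ι).symm ≫ Functor.whiskerLeft j τ)
    exact (htpy_of_natTrans t₁).trans (htpy_of_natTrans t₂).symm
  intro K hK
  refine ⟨fun g => ?_, fun h h' hh => ?_⟩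
  · obtain ⟨h, hh⟩ := (hC K hK).1 (nerveMap F ≫ g)
    refine ⟨h, (hP K hK).2 _ _ ?_⟩
    have e₁ := hh.precomp (nerveMap j)
    have e₂ := hjF.postcomp g
    rw [← Category.assoc, hj, Category.assoc] at e₁
    exact e₁.trans e₂
  · refine (hC K hK).2 _ _ ?_
    have e := hh.precomp (nerveMap F)
    have e₁ := hF.postcomp h
    have e₂ := hF.postcomp h'
    rw [Category.assoc] at e₁ e₂
    exact (e₁.symm.trans e).trans e₂

end FullSubcategoryNerve

section Zigzags

lemma ModelStructure.W_of_comp_eq_left (M : ModelStructure D) {X Y Z : D} {f : X ⟶ Y} {g : Y ⟶ Z}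
    {k : X ⟶ Z} (h : f ≫ g = k) (hg : M.W g) (hk : M.W k) : M.W f :=
  M.W_of_postcomp f g hg (h ▸ hk)

lemma ModelStructure.W_of_comp_eq_right (M : ModelStructure D) {X Y Z : D} {f : X ⟶ Y} {g : Y ⟶ Z}
    {k : X ⟶ Z} (h : f ≫ g = k) (hf : M.W f) (hk : M.W k) : M.W g :=
  M.W_of_precomp f g hf (h ▸ hk)

variable {M : ModelStructure D} {x y : D} {I : Type*} [Category* I]

/-- The functor to zigzags with given components. -/
def zigFunctor {a b : I ⥤ D} (f : a ⟶ (Functor.const I).obj x) (g : a ⟶ b)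
    (h : (Functor.const I).obj y ⟶ b) (hf : ∀ i, M.W (f.app i)) (hh : ∀ i, M.W (h.app i)) :
    I ⥤ Zig3 M x y where
  obj i := ⟨a.obj i, b.obj i, f.app i, g.app i, h.app i, hf i, hh i⟩
  map {i j} w :=
    have e : a.map w ≫ f.app j = f.app i := (f.naturality w).trans (Category.comp_id _)
    have e' : h.app i ≫ b.map w = h.app j := (h.naturality w).symm.trans (Category.id_comp _)
    Zig3Hom.mk (a.map w) (b.map w)
      (M.W_of_comp_eq_left e (hf j) (hf i))
      (M.W_of_comp_eq_right e' (hh i) (hh j)) e (g.naturality w) e'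
  map_id i := Zig3Hom.ext (a.map_id i) (b.map_id i)
  map_comp v w := Zig3Hom.ext (a.map_comp v w) (b.map_comp v w)

/-- The natural transformation of functors to zigzags with given components. -/
def zigTrans {a b a' b' : I ⥤ D} {f : a ⟶ (Functor.const I).obj x} {g : a ⟶ b}
    {h : (Functor.const I).obj y ⟶ b} {hf : ∀ i, M.W (f.app i)} {hh : ∀ i, M.W (h.app i)}
    {f' : a' ⟶ (Functor.const I).obj x} {g' : a' ⟶ b'}
    {h' : (Functor.const I).obj y ⟶ b'} {hf' : ∀ i, M.W (f'.app i)} {hh' : ∀ i, M.W (h'.app i)}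
    (p : a ⟶ a') (q : b ⟶ b') (ef : p ≫ f' = f) (eg : p ≫ g' = g ≫ q) (eh : h ≫ q = h') :
    zigFunctor f g h hf hh ⟶ zigFunctor f' g' h' hf' hh' where
  app i := Zig3Hom.mk (p.app i) (q.app i)
    (M.W_of_comp_eq_left (NatTrans.congr_app ef i) (hf' i) (hf i))
    (M.W_of_comp_eq_right (NatTrans.congr_app eh i) (hh i) (hh' i))
    (NatTrans.congr_app ef i) (NatTrans.congr_app eg i) (NatTrans.congr_app eh i)
  naturality _ _ w := Zig3Hom.ext (p.naturality w) (q.naturality w)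

lemma exists_eq_zigFunctor (H : I ⥤ Zig3 M x y) :
    ∃ (a b : I ⥤ D) (f : a ⟶ (Functor.const I).obj x) (g : a ⟶ b)
      (h : (Functor.const I).obj y ⟶ b) (hf : ∀ i, M.W (f.app i)) (hh : ∀ i, M.W (h.app i)),
      H = zigFunctor f g h hf hh :=
  ⟨{ obj := fun i => (H.obj i).a
     map := fun w => Zig3Hom.u (H.map w)
     map_id := fun i => congrArg Zig3Hom.u (H.map_id i)
     map_comp := fun v w => congrArg Zig3Hom.u (H.map_comp v w) },
   { obj := fun i => (H.obj i).b
     map := fun w => Zig3Hom.v (H.map w)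
     map_id := fun i => congrArg Zig3Hom.v (H.map_id i)
     map_comp := fun v w => congrArg Zig3Hom.v (H.map_comp v w) },
   { app := fun i => (H.obj i).f
     naturality := fun _ _ w => (Zig3Hom.comm_f (H.map w)).trans (Category.comp_id _).symm },
   { app := fun i => (H.obj i).g
     naturality := fun _ _ w => Zig3Hom.comm_g (H.map w) },
   { app := fun i => (H.obj i).h
     naturality := fun _ _ w => (Category.id_comp _).trans (Zig3Hom.comm_h (H.map w)).symm },
   fun i => (H.obj i).hf, fun i => (H.obj i).hh, rfl⟩

variable [HasFiniteLimits D] [HasFiniteColimits D] {deg : I → ℕ}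

lemma exists_resolution (hfin : ∀ i n, Finite (DegIndex deg n i))
    (hid : ∀ {i j : I} (u : i ⟶ j), deg j = deg i → ∃ e : i = j, u = eqToHom e)
    (hle : ∀ {i j : I}, (i ⟶ j) → deg j ≤ deg i) (H : I ⥤ Zig3 M x y) :
    ∃ G₁ G₂ : I ⥤ Zig3 M x y, Nonempty (H ⟶ G₁) ∧ Nonempty (G₂ ⟶ G₁) ∧
      (∀ i, M.Fib (G₂.obj i).f ∧ M.Cof (G₂.obj i).h) ∧
      ∀ i, M.Cof (H.obj i).h → M.Fib (G₁.obj i).f ∧ M.Cof (G₁.obj i).h := by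
  obtain ⟨a, b, f, g, h, hf, hh, rfl⟩ := exists_eq_zigFunctor H
  have := M.isWeakFactorizationSystem_acof_fib
  have := M.isWeakFactorizationSystem_cof_afib
  obtain ⟨a₁, p, f₁, hpf, hp, hf₁⟩ :=
    exists_reedy_factorization hfin hid (M.Cof ⊓ M.W) M.Fib hle f
  have hq (i : I) : M.Cof ((pushout.inr p g).app i) ∧ M.W ((pushout.inr p g).app i) :=
    M.Cof_of_isPushout ((IsPushout.of_hasPushout p g).flip.map ((evaluation I D).obj i)) (hp i)
  obtain ⟨b₂, h₂, q₂, hhq, hh₂, hq₂⟩ :=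
    exists_reedy_factorization hfin hid M.Cof (M.Fib ⊓ M.W) hle (h ≫ pushout.inr p g)
  let g₁ := pushout.inl p g
  have hp₂ (i : I) : M.Fib ((pullback.fst g₁ q₂).app i) ∧ M.W ((pullback.fst g₁ q₂).app i) :=
    M.Fib_of_isPullback ((IsPullback.of_hasPullback g₁ q₂).map ((evaluation I D).obj i)).flip
      (hq₂ i)
  have hf₁W (i : I) : M.W (f₁.app i) :=
    M.W_of_comp_eq_right (NatTrans.congr_app hpf i) (hp i).2 (hf i)
  have hh₁W (i : I) : M.W ((h ≫ pushout.inr p g).app i) := M.W_comp _ _ (hh i) (hq i).2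
  have hh₂W (i : I) : M.W (h₂.app i) :=
    M.W_of_comp_eq_left (NatTrans.congr_app hhq i) (hq₂ i).2 (hh₁W i)
  refine ⟨zigFunctor f₁ g₁ (h ≫ pushout.inr p g) hf₁W hh₁W,
    zigFunctor (pullback.fst g₁ q₂ ≫ f₁) (pullback.snd g₁ q₂) h₂
      (fun i => M.W_comp _ _ (hp₂ i).2 (hf₁W i)) hh₂W,
    ⟨zigTrans p (pushout.inr p g) hpf pushout.condition rfl⟩,
    ⟨zigTrans (pullback.fst g₁ q₂) q₂ rfl pullback.condition hhq⟩,
    fun i => ⟨M.Fib_comp _ _ (hp₂ i).1 (hf₁ i), hh₂ i⟩,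
    fun i hi => ⟨hf₁ i, M.Cof_comp _ _ hi (hq i).1⟩⟩

end Zigzags

/-- for a model category `D` and `x, y ∈ D`, the inclusion of the full
subcategory `Fun_{**}(3̃,D)^W` (zigzags whose left leg is an acyclic fibration and whose
right leg is an acyclic cofibration) into `Fun_{**}(3,D)^W` induces a weak homotopy
equivalence of nerves. -/
theorem statement1 [HasFiniteLimits D] [HasFiniteColimits D]
    (M : ModelStructure D) (x y : D) :
    IsWeakHomotopyEquiv (nerveMap (ObjectProperty.ι
      (fun A : Zig3 M x y => M.Fib A.f ∧ M.Cof A.h))) := by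
  obtain ⟨G₁, G₂, ⟨t₁⟩, ⟨t₂⟩, h₂, h₁⟩ := exists_resolution (deg := Chain.len)
    (fun X n => X.finite_hom n) (fun u h => Chain.eq_of_len_eq u h) Chain.len_le
    (Chain.head (Zig3 M x y))
  exact isWeakHomotopyEquiv_nerveMap_ι _ t₁ t₂ h₂ fun s hs => h₁ s hs.2

end Paper
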